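/- arXiv:1108.5288 — 9 statements merged into one kernel-verified Lean document; each statement's English description precedes it below -/
import Mathlib

section
/- Let 𝓕 be a set of functions with Boolean arguments and values in a subsemiring 𝒞 of the complex numbers. If G belongs to the pps_ω-definable functional clone ⟨𝓕⟩_ω, then ⟨𝓕 ∪ {G}⟩_ω = ⟨𝓕⟩_ω. -/
open scoped NNReal BigOperators

/-- Functions of arity `n` on the Boolean domain with values in `R`. -/
abbrev FnOn (R : Type) (n : ℕ) : Type := (Fin n → Bool) → R

/-- Functions of all arities on the Boolean domain with values in `R`. -/
abbrev Fn (R : Type) : Type := Σ n : ℕ, FnOn R n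

/-- The binary equality function: `EQ(x,x) = 1`, `EQ(x,y) = 0` for `x ≠ y`. -/
def EQfn (R : Type) [CommSemiring R] : Fn R :=
  ⟨2, fun x => if x 0 = x 1 then 1 else 0⟩

/-- `F` (of arity `n`) is representable by a pps-formula over `𝓕`: there are `m` bound
variables and `s` atomic formulas, the `j`-th atomic formula applying `G j ∈ 𝓕` to a
scope `σ j` of (possibly repeated) variables among the `n + m` variables; `F x` is the
sum over all Boolean assignments of the bound variables of the product of the values of
the atomic formulas. -/
def PpsRep (R : Type) [CommSemiring R] (𝓕 : Set (Fn R)) {n : ℕ} (F : FnOn R n) : Prop :=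
  ∃ (m s : ℕ) (G : Fin s → Fn R) (σ : (j : Fin s) → Fin (G j).1 → Fin (n + m)),
    (∀ j, G j ∈ 𝓕) ∧
    ∀ x : Fin n → Bool,
      F x = ∑ y : Fin m → Bool, ∏ j : Fin s, (G j).2 (fun i => Fin.append x y (σ j i))

/-- The functional clone `⟨𝓕⟩` generated by `𝓕`: all functions representable by a
pps-formula over `𝓕 ∪ {EQ}`. -/
def Clone (R : Type) [CommSemiring R] (𝓕 : Set (Fn R)) : Set (Fn R) :=
  {F | PpsRep R (𝓕 ∪ {EQfn R}) F.2}

/-- The pps_ω-definable functional clone `⟨𝓕⟩_ω`: all functions `F` such that for some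
finite `S ⊆ 𝓕 ∪ {EQ}` and every `ε > 0`, some function of the same arity representable
by a pps-formula over `S` is within `ε` of `F` in the sup norm. -/
def CloneOmega (R : Type) [CommSemiring R] [MetricSpace R] (𝓕 : Set (Fn R)) :
    Set (Fn R) :=
  {F | ∃ S : Set (Fn R), S ⊆ 𝓕 ∪ {EQfn R} ∧ S.Finite ∧
    ∀ ε : ℝ, 0 < ε → ∃ Fhat : FnOn R F.1, PpsRep R S Fhat ∧
      ∀ x : Fin F.1 → Bool, dist (Fhat x) (F.2 x) < ε}

/-- A pps-formula may be indexed by arbitrary finite types of bound variables and of atoms. -/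
theorem PpsRep.of_fintype {R : Type} [CommSemiring R] {T : Set (Fn R)} {n : ℕ} {F : FnOn R n}
    {β ι : Type} [Fintype β] [DecidableEq β] [Fintype ι] (G : ι → Fn R)
    (σ : (j : ι) → Fin (G j).1 → Fin n ⊕ β) (hG : ∀ j, G j ∈ T)
    (hF : ∀ x, F x = ∑ y : β → Bool, ∏ j, (G j).2 (fun i => Sum.elim x y (σ j i))) :
    PpsRep R T F := by
  let e := Fintype.equivFin β
  let f := (Fintype.equivFin ι).symm
  refine ⟨Fintype.card β, Fintype.card ι, fun j => G (f j),
    fun j i => Sum.elim (Fin.castAdd _) (fun b => Fin.natAdd n (e b)) (σ (f j) i),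
    fun j => hG _, fun x => ?_⟩
  rw [hF, ← (Equiv.arrowCongr e (Equiv.refl Bool)).sum_comp]
  refine Finset.sum_congr rfl fun y _ => ?_
  rw [← f.prod_comp]
  refine Finset.prod_congr rfl fun j _ => congrArg _ (funext fun i => ?_)
  beta_reduce
  generalize σ (f j) i = v
  rcases v with a | b <;> simp [Equiv.arrowCongr]

/-- Representable functions may be substituted for the atoms of a pps-formula. -/
theorem PpsRep.subst {R : Type} [CommSemiring R] {T : Set (Fn R)} {n m s : ℕ} {a : Fin s → ℕ}
    {H : (j : Fin s) → FnOn R (a j)} (hH : ∀ j, PpsRep R T (H j))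
    (σ : (j : Fin s) → Fin (a j) → Fin (n + m)) :
    PpsRep R T (fun x : Fin n → Bool =>
      ∑ y : Fin m → Bool, ∏ j, H j (fun i => Fin.append x y (σ j i))) := by
  choose k t K τ hK hrep using hH
  let free (v : Fin (n + m)) : Fin n ⊕ (Fin m ⊕ Σ j, Fin (k j)) :=
    Sum.map id Sum.inl (finSumFinEquiv.symm v)
  have hfree : ∀ (x : Fin n → Bool) (y : Fin m → Bool) (z : (Σ j, Fin (k j)) → Bool) v,
      Sum.elim x (Sum.elim y z) (free v) = Fin.append x y v := by
    intro x y z v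
    refine Fin.addCases (fun i => ?_) (fun i => ?_) v <;> simp [free]
  refine PpsRep.of_fintype (β := Fin m ⊕ Σ j, Fin (k j)) (ι := Σ j, Fin (t j))
    (fun p => K p.1 p.2)
    (fun p i => Sum.elim (fun u => free (σ p.1 u)) (fun b => Sum.inr (Sum.inr ⟨p.1, b⟩))
      (finSumFinEquiv.symm (τ p.1 p.2 i)))
    (fun p => hK _ _) fun x => ?_
  rw [← (Equiv.sumArrowEquivProdArrow _ _ _).symm.sum_comp, Fintype.sum_prod_type]
  refine Finset.sum_congr rfl fun y _ => ?_
  simp only [hrep]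
  rw [Fintype.prod_sum, ← (Equiv.piCurry fun _ _ => Bool).sum_comp]
  refine Finset.sum_congr rfl fun z _ => ?_
  rw [Fintype.prod_sigma]
  refine Finset.prod_congr rfl fun j _ => Finset.prod_congr rfl fun l _ =>
    congrArg _ (funext fun i => ?_)
  have hsum : ((Equiv.sumArrowEquivProdArrow _ _ _).symm (y, z) :
      (Fin m ⊕ Σ j, Fin (k j)) → Bool) = Sum.elim y z := rfl
  rw [hsum]
  generalize τ j l i = v
  refine Fin.addCases (fun u => ?_) (fun b => ?_) v
  · simp [hfree]
  · simp [Sigma.curry]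

/-- Every member of `T` is representable over `T`. -/
theorem PpsRep.of_mem {R : Type} [CommSemiring R] {T : Set (Fn R)} {A : Fn R} (hA : A ∈ T) :
    PpsRep R T A.2 :=
  PpsRep.of_fintype (β := Empty) (ι := Unit) (fun _ => A) (fun _ i => Sum.inl i) (fun _ => hA)
    fun x => by simp

/-- Representability is monotone in the set of available functions. -/
theorem PpsRep.mono {R : Type} [CommSemiring R] {S T : Set (Fn R)} (h : S ⊆ T) {n : ℕ}
    {F : FnOn R n} (hF : PpsRep R S F) : PpsRep R T F := by
  obtain ⟨m, s, G, σ, hG, hrep⟩ := hF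
  exact ⟨m, s, G, σ, fun j => h (hG j), hrep⟩

/-- The clone operator is monotone. -/
theorem CloneOmega.mono {R : Type} [CommSemiring R] [MetricSpace R] {𝓕 𝓖 : Set (Fn R)}
    (h : 𝓕 ⊆ 𝓖) : CloneOmega R 𝓕 ⊆ CloneOmega R 𝓖 :=
  fun _ ⟨S, hS, hfin, happrox⟩ =>
    ⟨S, hS.trans (Set.union_subset_union_left _ h), hfin, happrox⟩

open Classical in
/-- The values of `A`, with `g` in place of those of `G` when `A = G`. -/
noncomputable def replaceFn {R : Type} (G : Fn R) (g : FnOn R G.1) (A : Fn R) : FnOn R A.1 :=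
  if h : A = G then h ▸ g else A.2

theorem replaceFn_self {R : Type} (G : Fn R) (g : FnOn R G.1) : replaceFn G g G = g := by
  simp [replaceFn]

theorem replaceFn_of_ne {R : Type} {G A : Fn R} (g : FnOn R G.1) (h : A ≠ G) :
    replaceFn G g A = A.2 := by
  simp [replaceFn, h]

theorem replaceFn_snd {R : Type} (G A : Fn R) : replaceFn G G.2 A = A.2 := by
  by_cases h : A = G
  · subst h; exact replaceFn_self _ _
  · exact replaceFn_of_ne _ h

theorem continuous_replaceFn {R : Type} [TopologicalSpace R] (G A : Fn R) :
    Continuous fun g => replaceFn G g A := by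
  by_cases h : A = G
  · subst h; simpa only [replaceFn_self] using continuous_id'
  · simpa only [replaceFn_of_ne _ h] using continuous_const

/-- Adding to `𝓕` a member of its pps_ω-definable clone does not enlarge the clone. -/
theorem cloneOmega_union_singleton_subset {R : Type} [CommSemiring R] [MetricSpace R]
    [ContinuousAdd R] [ContinuousMul R] {𝓕 : Set (Fn R)} {G : Fn R} (hG : G ∈ CloneOmega R 𝓕) :
    CloneOmega R (𝓕 ∪ {G}) ⊆ CloneOmega R 𝓕 := by
  rintro F ⟨S, hS, hSfin, hF⟩
  obtain ⟨S', hS', hS'fin, hGapprox⟩ := hG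
  refine ⟨S \ {G} ∪ S', ?_, hSfin.sdiff.union hS'fin, fun ε hε => ?_⟩
  · rintro A (⟨hA, hAG⟩ | hA)
    · rcases hS hA with (h | h) | h
      · exact Or.inl h
      · exact absurd h hAG
      · exact Or.inr h
    · exact hS' hA
  obtain ⟨Fhat, ⟨m, s, A, σ, hA, hrep⟩, hFhat⟩ := hF (ε / 2) (half_pos hε)
  let Φ (g : FnOn R G.1) : FnOn R F.1 := fun x =>
    ∑ y : Fin m → Bool, ∏ j, replaceFn G g (A j) (fun i => Fin.append x y (σ j i))
  have hΦ : Continuous Φ := by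
    refine continuous_pi fun x => continuous_finsetSum _ fun y _ =>
      continuous_finsetProd _ fun j _ => ?_
    exact (continuous_apply _).comp (continuous_replaceFn G (A j))
  have hΦG : Φ G.2 = Fhat := by
    funext x
    simp only [Φ, replaceFn_snd, hrep]
  obtain ⟨δ, hδ, hclose⟩ := Metric.continuous_iff.mp hΦ G.2 (ε / 2) (half_pos hε)
  obtain ⟨g, hg, hgG⟩ := hGapprox δ hδ
  refine ⟨Φ g, PpsRep.subst (fun j => ?_) σ, fun x => ?_⟩
  · by_cases h : A j = G
    · rw [h, replaceFn_self]
      exact hg.mono Set.subset_union_right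
    · rw [replaceFn_of_ne _ h]
      exact PpsRep.of_mem (Or.inl ⟨hA j, h⟩)
  · have hx := (dist_pi_lt_iff (half_pos hε)).mp
      (hclose g ((dist_pi_lt_iff hδ).mpr hgG)) x
    rw [hΦG] at hx
    linarith [dist_triangle (Φ g x) (Fhat x) (F.2 x), hFhat x]

/-- Lemma 2 (`fclonelimTransitive`): if `G` is in the pps_ω-definable functional clone
generated by `𝓕` (with values in a subsemiring `𝒞` of `ℂ`), then
`⟨𝓕 ∪ {G}⟩_ω = ⟨𝓕⟩_ω`. -/
theorem cloneOmega_insert_eq_of_mem (𝒞 : Subsemiring ℂ) (𝓕 : Set (Fn ↥𝒞))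
    (G : Fn ↥𝒞) (hG : G ∈ CloneOmega ↥𝒞 𝓕) :
    CloneOmega ↥𝒞 (𝓕 ∪ {G}) = CloneOmega ↥𝒞 𝓕 := by
  exact (cloneOmega_union_singleton_subset hG).antisymm
    (CloneOmega.mono Set.subset_union_left)
end

section
/- Suppose 𝓕 is a set of functions F : {0,1}^n → ℝ≥0 (of varying arities n). Then the relational clone generated by {R_F : F ∈ 𝓕} equals {R_F : F ∈ ⟨𝓕⟩}, where ⟨𝓕⟩ is the functional clone generated by 𝓕. -/
open scoped NNReal BigOperators

/-- Boolean relations of arity `n` on the Boolean domain. -/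
abbrev RelOn (n : ℕ) : Type := (Fin n → Bool) → Prop

/-- Boolean relations of all arities. -/
abbrev BRel : Type := Σ n : ℕ, RelOn n

/-- The binary equality relation. -/
def EQrel : BRel := ⟨2, fun x => x 0 = x 1⟩

/-- `Q` (of arity `n`) is representable by a pp-formula over `𝓡`: an existential
quantification over `m` bound variables of a conjunction of `s` atomic formulas, each
applying a relation of `𝓡` to a scope of (possibly repeated) variables. -/
def PpRep (𝓡 : Set BRel) {n : ℕ} (Q : RelOn n) : Prop :=
  ∃ (m s : ℕ) (P : Fin s → BRel) (σ : (j : Fin s) → Fin (P j).1 → Fin (n + m)),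
    (∀ j, P j ∈ 𝓡) ∧
    ∀ x : Fin n → Bool,
      (Q x ↔ ∃ y : Fin m → Bool, ∀ j : Fin s, (P j).2 (fun i => Fin.append x y (σ j i)))

/-- The relational clone generated by `𝓡`: all relations representable by a pp-formula
over `𝓡 ∪ {EQ}`. -/
def RClone (𝓡 : Set BRel) : Set BRel := {Q | PpRep (𝓡 ∪ {EQrel}) Q.2}

/-- The underlying relation `R_F` of a nonnegative function `F`: `R_F(x) = 1` iff
`F(x) > 0`. -/
def underlyingRel (F : Fn ℝ≥0) : BRel := ⟨F.1, fun x => 0 < F.2 x⟩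

theorem underlyingRel_EQfn : underlyingRel (EQfn ℝ≥0) = EQrel := by
  refine congrArg (Sigma.mk 2) (funext fun x : Fin 2 → Bool => propext ?_)
  change 0 < (if x 0 = x 1 then (1 : ℝ≥0) else 0) ↔ x 0 = x 1
  by_cases h : x 0 = x 1 <;> simp [h]

/-- A sum of products of nonnegative reals is positive iff some product has only positive
factors. -/
theorem sum_prod_pos_iff {ι κ : Type*} [Fintype ι] [Fintype κ] (f : ι → κ → ℝ≥0) :
    0 < ∑ y, ∏ j, f y j ↔ ∃ y, ∀ j, 0 < f y j := by
  simp [pos_iff_ne_zero, Finset.prod_eq_zero_iff]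

/-- Over a set of nonnegative functions, pp-formulas in the underlying relations define exactly
the underlying relations of the pps-definable functions. -/
theorem setOf_ppRep_image_underlyingRel (S : Set (Fn ℝ≥0)) :
    {Q : BRel | PpRep (underlyingRel '' S) Q.2} =
      underlyingRel '' {F | PpsRep ℝ≥0 S F.2} := by
  ext ⟨n, Q⟩
  constructor
  · rintro ⟨m, s, P, σ, hP, hQ⟩
    choose G hG hGP using hP
    obtain rfl : (fun j => underlyingRel (G j)) = P := funext hGP
    refine ⟨⟨n, fun x => ∑ y : Fin m → Bool, ∏ j : Fin s,
      (G j).2 (fun i => Fin.append x y (σ j i))⟩, ⟨m, s, G, σ, hG, fun _ => rfl⟩, ?_⟩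
    refine congrArg (Sigma.mk n) (funext fun x => propext ?_)
    exact (sum_prod_pos_iff _).trans (hQ x).symm
  · rintro ⟨F, ⟨m, s, G, σ, hG, hF⟩, hFQ⟩
    rw [← hFQ]
    refine ⟨m, s, fun j => underlyingRel (G j), σ, fun j => ⟨G j, hG j, rfl⟩, fun x => ?_⟩
    change 0 < F.2 x ↔ _
    rw [hF x]
    exact sum_prod_pos_iff _

/-- Lemma (underlying relations): the relational clone generated by
`{R_F : F ∈ 𝓕}` equals `{R_F : F ∈ ⟨𝓕⟩}`. -/
theorem rclone_underlying (𝓕 : Set (Fn ℝ≥0)) :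
    RClone (underlyingRel '' 𝓕) = underlyingRel '' (Clone ℝ≥0 𝓕) := by
  have h : underlyingRel '' 𝓕 ∪ {EQrel} = underlyingRel '' (𝓕 ∪ {EQfn ℝ≥0}) := by
    rw [Set.image_union, Set.image_singleton, underlyingRel_EQfn]
  rw [RClone, h]
  exact setOf_ppRep_image_underlyingRel _
end

section
/- Let G : {0,1}^{n+m} → ℝ≥0 and define G' : {0,1}^n → ℝ≥0 by G'(x) = Σ_{z∈{0,1}^m} G(x,z). If G is log-supermodular, then G' is log-supermodular. -/
open scoped NNReal BigOperators

/-- A nonnegative function on `{0,1}^n` is log-supermodular (lsm) if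
`F(x ∨ y) · F(x ∧ y) ≥ F(x) · F(y)` for all `x, y`, with `∨, ∧` componentwise. -/
def IsLSM {n : ℕ} (F : FnOn ℝ≥0 n) : Prop :=
  ∀ x y : Fin n → Bool, F x * F y ≤ F (x ⊔ y) * F (x ⊓ y)

theorem Fin.append_sup_append {α : Type*} [Max α] {n m : ℕ} (x y : Fin n → α) (a b : Fin m → α) :
    Fin.append x a ⊔ Fin.append y b = Fin.append (x ⊔ y) (a ⊔ b) := by
  ext i
  refine Fin.addCases (fun j => ?_) (fun j => ?_) i <;> simp

theorem Fin.append_inf_append {α : Type*} [Min α] {n m : ℕ} (x y : Fin n → α) (a b : Fin m → α) :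
    Fin.append x a ⊓ Fin.append y b = Fin.append (x ⊓ y) (a ⊓ b) := by
  ext i
  refine Fin.addCases (fun j => ?_) (fun j => ?_) i <;> simp

/-- Lemma (summing out variables preserves log-supermodularity): if
`G : {0,1}^{n+m} → ℝ≥0` is lsm, then `G'(x) = Σ_{z ∈ {0,1}^m} G(x, z)` is lsm. -/
theorem isLSM_sum_out (n m : ℕ) (G : FnOn ℝ≥0 (n + m)) (hG : IsLSM G) :
    IsLSM (fun x : Fin n → Bool => ∑ z : Fin m → Bool, G (Fin.append x z)) := by
  intro x y
  rw [mul_comm (∑ z, G (Fin.append (x ⊔ y) z))]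
  refine four_functions_theorem_univ (fun z => G (Fin.append x z)) (fun z => G (Fin.append y z))
    (fun z => G (Fin.append (x ⊓ y) z)) (fun z => G (Fin.append (x ⊔ y) z))
    (fun _ => zero_le) (fun _ => zero_le) (fun _ => zero_le) (fun _ => zero_le) fun a b => ?_
  rw [mul_comm (G (Fin.append (x ⊓ y) _)), ← Fin.append_sup_append, ← Fin.append_inf_append]
  exact hG _ _
end

section
/- If 𝓕 is a set of log-supermodular functions, then every function in the pps_ω-definable functional clone ⟨𝓕⟩_ω is log-supermodular; in particular, functions obtained from lsm functions by products, by summing out variables, and by uniform limits are lsm. -/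
open scoped NNReal BigOperators

/-- `LSM`: the set of all log-supermodular functions (of all arities). -/
def LSMset : Set (Fn ℝ≥0) := {F | IsLSM F.2}

/-- The equality function is log-supermodular. -/
lemma isLSM_EQfn : IsLSM (EQfn ℝ≥0).2 := by
  change IsLSM fun x : Fin 2 → Bool => if x 0 = x 1 then 1 else 0
  intro x y
  by_cases hx : x 0 = x 1 <;> by_cases hy : y 0 = y 1 <;> simp [hx, hy]

namespace IsLSM

variable {n : ℕ}

/-- Renaming (and possibly identifying) variables preserves log-supermodularity. -/
lemma comp_variables {k : ℕ} {F : FnOn ℝ≥0 n} (hF : IsLSM F) (σ : Fin n → Fin k) :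
    IsLSM fun x : Fin k → Bool => F fun i => x (σ i) :=
  fun x y => hF (fun i => x (σ i)) fun i => y (σ i)

/-- Finite products of log-supermodular functions are log-supermodular. -/
lemma prod {ι : Type*} (s : Finset ι) {F : ι → FnOn ℝ≥0 n} (hF : ∀ j ∈ s, IsLSM (F j)) :
    IsLSM fun x => ∏ j ∈ s, F j x := by
  intro x y
  simp only [← Finset.prod_mul_distrib]
  exact Finset.prod_le_prod' fun j hj => hF j hj x y

/-- Summing out variables preserves log-supermodularity. -/
lemma sum_append {m : ℕ} {F : FnOn ℝ≥0 (n + m)} (hF : IsLSM F) :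
    IsLSM fun x : Fin n → Bool => ∑ y : Fin m → Bool, F (Fin.append x y) := by
  intro x x'
  rw [mul_comm (∑ y, F (Fin.append (x ⊔ x') y))]
  refine four_functions_theorem_univ (fun y => F (Fin.append x y))
    (fun y => F (Fin.append x' y)) (fun y => F (Fin.append (x ⊓ x') y))
    (fun y => F (Fin.append (x ⊔ x') y)) (fun _ => zero_le) (fun _ => zero_le)
    (fun _ => zero_le) (fun _ => zero_le) fun y y' => ?_
  have hsup : Fin.append (x ⊔ x') (y ⊔ y') = Fin.append x y ⊔ Fin.append x' y' := by
    ext i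
    refine Fin.addCases (fun i => ?_) (fun i => ?_) i <;> simp
  have hinf : Fin.append (x ⊓ x') (y ⊓ y') = Fin.append x y ⊓ Fin.append x' y' := by
    ext i
    refine Fin.addCases (fun i => ?_) (fun i => ?_) i <;> simp
  rw [hsup, hinf, mul_comm (F (_ ⊓ _))]
  exact hF _ _

end IsLSM

/-- Functions representable by a pps-formula over log-supermodular functions are
log-supermodular. -/
lemma PpsRep.isLSM {𝓕 : Set (Fn ℝ≥0)} (h𝓕 : 𝓕 ⊆ LSMset) {n : ℕ} {F : FnOn ℝ≥0 n}
    (hF : PpsRep ℝ≥0 𝓕 F) : IsLSM F := by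
  obtain ⟨m, s, G, σ, hG, hF⟩ := hF
  rw [show F = _ from funext hF]
  exact IsLSM.sum_append (F := fun z => ∏ j, (G j).2 fun i => z (σ j i)) <|
    IsLSM.prod _ fun j _ => IsLSM.comp_variables (h𝓕 (hG j)) (σ j)

/-- The log-supermodular functions of a given arity form a closed set. -/
lemma isClosed_setOf_isLSM (n : ℕ) : IsClosed {F : FnOn ℝ≥0 n | IsLSM F} := by
  simp only [IsLSM, Set.ofPred_forall]
  exact isClosed_iInter fun x => isClosed_iInter fun y =>
    isClosed_le (by fun_prop) (by fun_prop)

/-- Lemma (`lsmClosure`): if every function of `𝓕` is log-supermodular, then every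
function in the pps_ω-definable functional clone `⟨𝓕⟩_ω` is log-supermodular. -/
theorem cloneOmega_subset_lsm (𝓕 : Set (Fn ℝ≥0)) (h𝓕 : 𝓕 ⊆ LSMset) :
    CloneOmega ℝ≥0 𝓕 ⊆ LSMset := by
  rintro ⟨n, F⟩ ⟨S, hS, -, happrox⟩
  have hS_lsm : S ⊆ LSMset :=
    hS.trans <| Set.union_subset h𝓕 <| Set.singleton_subset_iff.2 isLSM_EQfn
  refine (isClosed_setOf_isLSM n).closure_subset <| Metric.mem_closure_iff.2 fun ε hε => ?_
  obtain ⟨Fhat, hrep, hdist⟩ := happrox ε hε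
  refine ⟨Fhat, hrep.isLSM hS_lsm, ?_⟩
  rw [dist_comm]
  exact (dist_pi_lt_iff hε).2 hdist
end

section
/- Let F : {0,1}^4 → ℝ≥0 be defined by F(1,1,0,0) = F(0,0,1,1) = 1 and F(x) = 0 for all other x ∈ {0,1}^4. Then every 2-pinning of F is log-modular, but F is not log-supermodular. -/
open scoped NNReal BigOperators

/-- A nonnegative function on `{0,1}^n` is log-modular if
`F(x ∨ y) · F(x ∧ y) = F(x) · F(y)` for all `x, y`. -/
def IsLogModular {n : ℕ} (F : FnOn ℝ≥0 n) : Prop :=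
  ∀ x y : Fin n → Bool, F (x ⊔ y) * F (x ⊓ y) = F x * F y

/-- The 2-pinning of `F` at distinct indices `i, j` with constants `c`: the binary
function `(u₀, u₁) ↦ F(x)` where `x i = u₀`, `x j = u₁`, and `x t = c t` for all other
coordinates `t`. -/
def TwoPinning {n : ℕ} (F : FnOn ℝ≥0 n) (i j : Fin n) (c : Fin n → Bool) :
    FnOn ℝ≥0 2 :=
  fun u => F (fun t => if t = i then u 0 else if t = j then u 1 else c t)

/-- The function with `F(1,1,0,0) = F(0,0,1,1) = 1` and `F(x) = 0` otherwise. -/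
def F6 : FnOn ℝ≥0 4 := fun x =>
  if x = ![true, true, false, false] ∨ x = ![false, false, true, true] then 1 else 0

/-- A function with at most one point in its support is log-modular. -/
theorem IsLogModular.of_support_subsingleton {n : ℕ} {F : FnOn ℝ≥0 n}
    (hF : F.support.Subsingleton) : IsLogModular F := by
  intro x y
  by_cases hxy : x = y
  · simp [hxy]
  have hr : F x * F y = 0 := by
    by_contra h
    exact hxy (hF (left_ne_zero_of_mul h) (right_ne_zero_of_mul h))
  have hl : F (x ⊔ y) * F (x ⊓ y) = 0 := by
    by_contra h
    exact hxy (sup_eq_inf.mp (hF (left_ne_zero_of_mul h) (right_ne_zero_of_mul h)))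
  rw [hl, hr]

/-- The two support points of `F6` differ in every coordinate. -/
theorem F6_eq_of_apply_eq {x y : Fin 4 → Bool} (hx : F6 x ≠ 0) (hy : F6 y ≠ 0)
    {t : Fin 4} (h : x t = y t) : x = y := by
  simp only [F6, ne_eq, ite_eq_right_iff, one_ne_zero, imp_false, not_not] at hx hy
  rcases hx with rfl | rfl <;> rcases hy with rfl | rfl <;> first | rfl | (fin_cases t <;> simp at h)

theorem support_twoPinning_F6_subsingleton {i j : Fin 4} (c : Fin 4 → Bool) (hij : i ≠ j) :
    (TwoPinning F6 i j c).support.Subsingleton := by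
  intro u hu v hv
  obtain ⟨t, hti, htj⟩ : ∃ t : Fin 4, t ≠ i ∧ t ≠ j := by
    clear hij hu hv
    revert i j
    decide
  have h := F6_eq_of_apply_eq hu hv (t := t) (by simp [hti, htj])
  ext k
  fin_cases k
  · simpa using congrFun h i
  · simpa [hij.symm] using congrFun h j

/-- Remark after Lemma (Topkis): every 2-pinning of `F6` is log-modular, but `F6` is not
log-supermodular. -/
theorem F6_counterexample :
    (∀ (i j : Fin 4) (c : Fin 4 → Bool), i ≠ j → IsLogModular (TwoPinning F6 i j c)) ∧
    ¬ IsLSM F6 := by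
  refine ⟨fun i j c hij =>
    .of_support_subsingleton (support_twoPinning_F6_subsingleton c hij), fun h => ?_⟩
  have key := h ![true, true, false, false] ![false, false, true, true]
  have hsup : (![true, true, false, false] ⊔ ![false, false, true, true] : Fin 4 → Bool) =
      ![true, true, true, true] := by decide
  rw [hsup] at key
  simp [F6] at key
end

section
/- NEQ is not in the pps_ω-definable functional clone ⟨IMP, ℬ₁⟩_ω, and IMP is not in the pps_ω-definable functional clone ⟨NEQ, ℬ₁⟩_ω; consequently the clones ⟨NEQ, ℬ₁⟩_ω and ⟨IMP, ℬ₁⟩_ω are incomparable under inclusion. Moreover, every binary function in ⟨NEQ, ℬ₁⟩_ω has one of the three forms U₁(x)U₂(y), U(x)·EQ(x,y), or U(x)·NEQ(x,y) for unary functions U, U₁, U₂. -/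
open scoped NNReal BigOperators

/-- `IMP(x,y) = 0` if `(x,y) = (1,0)`, and `1` otherwise. -/
def IMPfn : Fn ℝ≥0 := ⟨2, fun x => if x 0 = true ∧ x 1 = false then 0 else 1⟩

/-- `NEQ(x,y) = 1` iff `x ≠ y`, else `0`. -/
def NEQfn : Fn ℝ≥0 := ⟨2, fun x => if x 0 ≠ x 1 then 1 else 0⟩

/-- `OR(x,y) = 0` if `(x,y) = (0,0)`, and `1` otherwise. -/
def ORfn : Fn ℝ≥0 := ⟨2, fun x => if x 0 = false ∧ x 1 = false then 0 else 1⟩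

/-- `ℬ₁`: the set of all unary functions `{0,1} → ℝ≥0`. -/
def unaryFns : Set (Fn ℝ≥0) := {F | F.1 = 1}

theorem mem_cloneOmega_of_mem {R : Type} [CommSemiring R] [MetricSpace R] {𝓕 : Set (Fn R)}
    {F : Fn R} (hF : F ∈ 𝓕) : F ∈ CloneOmega R 𝓕 := by
  refine ⟨{F}, by simp [hF], Set.finite_singleton F, fun ε hε => ⟨F.2, ?_, by simp [hε]⟩⟩
  refine ⟨0, 1, fun _ => F, fun _ i => Fin.castAdd 0 i, by simp, fun x => ?_⟩
  rw [Fintype.sum_unique, Fin.prod_univ_one]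
  exact congrArg F.2 (funext fun i => (Fin.append_left x _ i).symm)

/-- A closed property shared by all functions of arity `n` representable over `𝓕 ∪ {EQ}` holds
for all functions of arity `n` in the clone `⟨𝓕⟩_ω`. -/
theorem mem_of_isClosed_of_mem_cloneOmega {R : Type} [CommSemiring R] [MetricSpace R]
    {𝓕 : Set (Fn R)} {n : ℕ} {K : Set (FnOn R n)} (hK : IsClosed K)
    (hrep : ∀ F : FnOn R n, PpsRep R (𝓕 ∪ {EQfn R}) F → F ∈ K)
    {F : FnOn R n} (hF : (⟨n, F⟩ : Fn R) ∈ CloneOmega R 𝓕) : F ∈ K := by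
  obtain ⟨S, hS, -, happ⟩ := hF
  rw [← hK.closure_eq, Metric.mem_closure_iff]
  intro ε hε
  obtain ⟨H, ⟨m, s, G, σ, hG, hsum⟩, hdist⟩ := happ ε hε
  refine ⟨H, hrep H ⟨m, s, G, σ, fun j => hS (hG j), hsum⟩, ?_⟩
  rw [dist_pi_lt_iff hε]
  intro x
  rw [dist_comm]
  exact hdist x

/-- Log-supermodularity of a function on the Boolean lattice. -/
def LogSupermodular {n : ℕ} (F : FnOn ℝ≥0 n) : Prop :=
  ∀ a b : Fin n → Bool, F a * F b ≤ F (a ⊓ b) * F (a ⊔ b)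

theorem logSupermodular_of_arity_one {G : Fn ℝ≥0} (hG : G.1 = 1) : LogSupermodular G.2 := by
  obtain ⟨n, g⟩ := G
  obtain rfl : n = 1 := hG
  intro a b
  rcases le_total (a 0) (b 0) with h | h
  · have hab : a ≤ b := fun i => by rw [Subsingleton.elim i 0]; exact h
    simp [inf_eq_left.2 hab, sup_eq_right.2 hab]
  · have hab : b ≤ a := fun i => by rw [Subsingleton.elim i 0]; exact h
    simp [inf_eq_right.2 hab, sup_eq_left.2 hab, mul_comm]

theorem logSupermodular_IMPfn : LogSupermodular IMPfn.2 := by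
  change LogSupermodular (n := 2) fun x => if x 0 = true ∧ x 1 = false then 0 else 1
  intro a b
  simp only [Pi.inf_apply, Pi.sup_apply]
  rcases Bool.eq_false_or_eq_true (a 0) with h₀ | h₀ <;>
    rcases Bool.eq_false_or_eq_true (a 1) with h₁ | h₁ <;>
    rcases Bool.eq_false_or_eq_true (b 0) with h₂ | h₂ <;>
    rcases Bool.eq_false_or_eq_true (b 1) with h₃ | h₃ <;>
    simp [h₀, h₁, h₂, h₃]

theorem logSupermodular_EQfn : LogSupermodular (EQfn ℝ≥0).2 := by
  change LogSupermodular (n := 2) fun x => if x 0 = x 1 then 1 else 0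
  intro a b
  simp only [Pi.inf_apply, Pi.sup_apply]
  rcases Bool.eq_false_or_eq_true (a 0) with h₀ | h₀ <;>
    rcases Bool.eq_false_or_eq_true (a 1) with h₁ | h₁ <;>
    rcases Bool.eq_false_or_eq_true (b 0) with h₂ | h₂ <;>
    rcases Bool.eq_false_or_eq_true (b 1) with h₃ | h₃ <;>
    simp [h₀, h₁, h₂, h₃]

theorem append_inf {α : Type} [Lattice α] {n m : ℕ} (a b : Fin n → α) (y z : Fin m → α) :
    Fin.append (a ⊓ b) (y ⊓ z) = Fin.append a y ⊓ Fin.append b z := by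
  ext i
  refine Fin.addCases (fun i => ?_) (fun i => ?_) i <;> simp

theorem append_sup {α : Type} [Lattice α] {n m : ℕ} (a b : Fin n → α) (y z : Fin m → α) :
    Fin.append (a ⊔ b) (y ⊔ z) = Fin.append a y ⊔ Fin.append b z := by
  ext i
  refine Fin.addCases (fun i => ?_) (fun i => ?_) i <;> simp

/-- Log-supermodularity is preserved by pps-formulas, by the four functions theorem. -/
theorem PpsRep.logSupermodular {𝓕 : Set (Fn ℝ≥0)} (h𝓕 : ∀ G ∈ 𝓕, LogSupermodular G.2) {n : ℕ}
    {F : FnOn ℝ≥0 n} (hF : PpsRep ℝ≥0 𝓕 F) : LogSupermodular F := by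
  obtain ⟨m, s, G, σ, hG, hsum⟩ := hF
  intro a b
  rw [hsum, hsum, hsum, hsum]
  refine four_functions_theorem_univ _ _ _ _ (fun _ => zero_le) (fun _ => zero_le)
    (fun _ => zero_le) (fun _ => zero_le) fun y z => ?_
  rw [← Finset.prod_mul_distrib, ← Finset.prod_mul_distrib]
  refine Finset.prod_le_prod' fun j _ => ?_
  rw [append_inf, append_sup]
  exact h𝓕 _ (hG j) _ _

theorem isClosed_setOf_logSupermodular (n : ℕ) :
    IsClosed {F : FnOn ℝ≥0 n | LogSupermodular F} := by
  simp only [LogSupermodular, Set.ofPred_forall]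
  exact isClosed_iInter fun a => isClosed_iInter fun b =>
    isClosed_le (by fun_prop) (by fun_prop)

theorem NEQfn_notMem_cloneOmega_IMPfn :
    NEQfn ∉ CloneOmega ℝ≥0 ({IMPfn} ∪ unaryFns) := by
  intro h
  have key : LogSupermodular (n := 2) fun x => if x 0 ≠ x 1 then 1 else 0 := by
    refine mem_of_isClosed_of_mem_cloneOmega (isClosed_setOf_logSupermodular 2)
      (fun F hF => hF.logSupermodular ?_) h
    rintro G ((rfl | hG) | rfl)
    · exact logSupermodular_IMPfn
    · exact logSupermodular_of_arity_one hG
    · exact logSupermodular_EQfn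
  have := key ![true, false] ![false, true]
  simp at this

/-- On the support of `G`, the parity of any two coordinates is constant. -/
def ParityRigid {n : ℕ} (G : FnOn ℝ≥0 n) : Prop :=
  ∀ i k : Fin n, ∃ c : Bool, ∀ w, G w ≠ 0 → (w i ^^ w k) = c

theorem parityRigid_of_arity_one {G : Fn ℝ≥0} (hG : G.1 = 1) : ParityRigid G.2 := by
  obtain ⟨n, g⟩ := G
  obtain rfl : n = 1 := hG
  intro i k
  exact ⟨false, fun w _ => by rw [Subsingleton.elim i k, Bool.xor_self]⟩

theorem parityRigid_EQfn : ParityRigid (EQfn ℝ≥0).2 := by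
  intro (i : Fin 2) (k : Fin 2)
  refine ⟨false, fun (w : Fin 2 → Bool) hw => ?_⟩
  have h : w 0 = w 1 := by simpa [EQfn] using hw
  fin_cases i <;> fin_cases k <;> simp [h]

theorem parityRigid_NEQfn : ParityRigid NEQfn.2 := by
  intro (i : Fin 2) (k : Fin 2)
  refine ⟨decide (i ≠ k), fun (w : Fin 2 → Bool) hw => ?_⟩
  have h : w 0 ≠ w 1 := by simpa [NEQfn] using hw
  revert h
  fin_cases i <;> fin_cases k <;> cases h0 : w 0 <;> cases h1 : w 1 <;> simp [h0, h1]

/-- The matrix of a binary function is singular, diagonal or antidiagonal. -/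
def SingularOrMonomial (F : FnOn ℝ≥0 2) : Prop :=
  F ![false, false] * F ![true, true] = F ![false, true] * F ![true, false] ∨
  (F ![false, true] = 0 ∧ F ![true, false] = 0) ∨
  (F ![false, false] = 0 ∧ F ![true, true] = 0)

theorem isClosed_setOf_singularOrMonomial :
    IsClosed {F : FnOn ℝ≥0 2 | SingularOrMonomial F} := by
  simp only [SingularOrMonomial, Set.ofPred_or, Set.ofPred_and]
  refine (isClosed_eq (by fun_prop) (by fun_prop)).union (IsClosed.union ?_ ?_) <;>
    exact (isClosed_eq (by fun_prop) (by fun_prop)).inter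
      (isClosed_eq (by fun_prop) (by fun_prop))

/-- Exchanging, between two assignments, the values of all variables outside `C` permutes pairs
of assignments of the bound variables; if no scope crosses the boundary of `C`, this preserves the
product of the weights. -/
theorem sum_mul_sum_eq_of_separated {m : ℕ} {P : (Fin (2 + m) → Bool) → ℝ≥0}
    (C : Fin (2 + m) → Prop) [DecidablePred C]
    (h0 : C (Fin.castAdd m 0)) (h1 : ¬ C (Fin.castAdd m 1))
    (hP : ∀ z w, P z * P w =
      P (fun v => if C v then z v else w v) * P (fun v => if C v then w v else z v))
    (a b c d : Bool) :
    (∑ y, P (Fin.append ![a, b] y)) * (∑ y, P (Fin.append ![c, d] y)) =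
      (∑ y, P (Fin.append ![a, d] y)) * (∑ y, P (Fin.append ![c, b] y)) := by
  have hmix : ∀ (a b c d : Bool) (y z : Fin m → Bool),
      (fun v => if C v then Fin.append ![a, b] y v else Fin.append ![c, d] z v) =
        Fin.append ![a, d] (fun v => if C (Fin.natAdd 2 v) then y v else z v) := by
    intro a b c d y z
    ext v
    refine Fin.addCases (fun i => ?_) (fun i => ?_) v
    · fin_cases i
      · simp [h0]
      · simp [h1]
    · simp
  rw [Finset.sum_mul_sum, Finset.sum_mul_sum, ← Finset.sum_product', ← Finset.sum_product']
  let e : (Fin m → Bool) × (Fin m → Bool) → (Fin m → Bool) × (Fin m → Bool) := fun p =>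
    (fun v => if C (Fin.natAdd 2 v) then p.1 v else p.2 v,
      fun v => if C (Fin.natAdd 2 v) then p.2 v else p.1 v)
  have he : Function.Involutive e := by
    rintro ⟨y, z⟩
    ext v <;> simp only [e] <;> split_ifs <;> rfl
  refine Finset.sum_bij' (fun p _ => e p) (fun p _ => e p) (by simp) (by simp)
    (fun p _ => he p) (fun p _ => he p) fun p _ => ?_
  rw [hP, hmix, hmix]

theorem PpsRep.singularOrMonomial {𝓕 : Set (Fn ℝ≥0)} (h𝓕 : ∀ G ∈ 𝓕, ParityRigid G.2)
    {F : FnOn ℝ≥0 2} (hF : PpsRep ℝ≥0 𝓕 F) : SingularOrMonomial F := by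
  classical
  obtain ⟨m, s, G, σ, hG, hsum⟩ := hF
  set P : (Fin (2 + m) → Bool) → ℝ≥0 := fun z => ∏ j, (G j).2 (fun i => z (σ j i)) with hPdef
  replace hsum : ∀ x, F x = ∑ y, P (Fin.append x y) := hsum
  let r : Fin (2 + m) → Fin (2 + m) → Prop := fun u v => ∃ j i k, u = σ j i ∧ v = σ j k
  by_cases hconn : Relation.EqvGen r (Fin.castAdd m 0) (Fin.castAdd m 1)
  · have hpar : ∀ u v, Relation.EqvGen r u v → ∃ c : Bool, ∀ z, P z ≠ 0 → (z u ^^ z v) = c := by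
      intro u v huv
      induction huv with
      | rel u v h =>
        obtain ⟨j, i, k, rfl, rfl⟩ := h
        obtain ⟨c, hc⟩ := h𝓕 _ (hG j) i k
        exact ⟨c, fun z hz => hc _ (Finset.prod_ne_zero_iff.1 hz j (Finset.mem_univ j))⟩
      | refl u => exact ⟨false, fun z _ => Bool.xor_self _⟩
      | symm u v _ ih =>
        obtain ⟨c, hc⟩ := ih
        exact ⟨c, fun z hz => by rw [Bool.xor_comm]; exact hc z hz⟩
      | trans u v w _ _ ih₁ ih₂ =>
        obtain ⟨c, hc⟩ := ih₁
        obtain ⟨d, hd⟩ := ih₂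
        refine ⟨c ^^ d, fun z hz => ?_⟩
        rw [← hc z hz, ← hd z hz]
        cases z u <;> cases z v <;> cases z w <;> rfl
    obtain ⟨c, hc⟩ := hpar _ _ hconn
    have hzero : ∀ a b : Bool, (a ^^ b) ≠ c → F ![a, b] = 0 := by
      intro a b hab
      rw [hsum]
      refine Finset.sum_eq_zero fun y _ => ?_
      by_contra hne
      apply hab
      have h := hc _ hne
      rwa [Fin.append_left, Fin.append_left] at h
    cases c
    · exact Or.inr (Or.inl ⟨hzero _ _ (by decide), hzero _ _ (by decide)⟩)
    · exact Or.inr (Or.inr ⟨hzero _ _ (by decide), hzero _ _ (by decide)⟩)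
  · left
    simp only [hsum]
    refine sum_mul_sum_eq_of_separated (Relation.EqvGen r (Fin.castAdd m 0))
      (Relation.EqvGen.refl _) hconn (fun z w => ?_) _ _ _ _
    simp only [hPdef]
    rw [← Finset.prod_mul_distrib, ← Finset.prod_mul_distrib]
    refine Finset.prod_congr rfl fun j _ => ?_
    by_cases hj : ∃ i, Relation.EqvGen r (Fin.castAdd m 0) (σ j i)
    · obtain ⟨i, hi⟩ := hj
      have hall : ∀ k, Relation.EqvGen r (Fin.castAdd m 0) (σ j k) := fun k =>
        hi.trans _ _ _ (Relation.EqvGen.rel _ _ ⟨j, i, k, rfl, rfl⟩)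
      simp only [hall, if_true]
    · simp only [not_exists] at hj
      simp only [hj, if_false]
      exact mul_comm _ _

theorem singularOrMonomial_of_mem_cloneOmega_NEQfn {F : FnOn ℝ≥0 2}
    (hF : (⟨2, F⟩ : Fn ℝ≥0) ∈ CloneOmega ℝ≥0 ({NEQfn} ∪ unaryFns)) : SingularOrMonomial F := by
  refine mem_of_isClosed_of_mem_cloneOmega isClosed_setOf_singularOrMonomial
    (fun F hF => hF.singularOrMonomial ?_) hF
  rintro G ((rfl | hG) | rfl)
  · exact parityRigid_NEQfn
  · exact parityRigid_of_arity_one hG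
  · exact parityRigid_EQfn

theorem IMPfn_notMem_cloneOmega_NEQfn :
    IMPfn ∉ CloneOmega ℝ≥0 ({NEQfn} ∪ unaryFns) := by
  intro h
  have key : SingularOrMonomial IMPfn.2 := singularOrMonomial_of_mem_cloneOmega_NEQfn h
  simp [SingularOrMonomial, IMPfn] at key

theorem forall_fin_two_bool {p : (Fin 2 → Bool) → Prop} (hff : p ![false, false])
    (hft : p ![false, true]) (htf : p ![true, false]) (htt : p ![true, true]) : ∀ x, p x := by
  intro x
  have hx : x = ![x 0, x 1] := by
    ext i
    fin_cases i <;> rfl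
  rw [hx]
  cases x 0 <;> cases x 1 <;> assumption

/-- A nonnegative `2 × 2` matrix with vanishing determinant has rank at most one. -/
theorem exists_eq_mul_of_singular {G : FnOn ℝ≥0 2}
    (h : G ![false, false] * G ![true, true] = G ![false, true] * G ![true, false]) :
    ∃ U₁ U₂ : Bool → ℝ≥0, ∀ x, G x = U₁ (x 0) * U₂ (x 1) := by
  by_cases hff : G ![false, false] = 0
  · by_cases hft : G ![false, true] = 0
    · refine ⟨fun a => if a then 1 else 0, fun b => G ![true, b], forall_fin_two_bool ?_ ?_ ?_ ?_⟩
        <;> simp [hff, hft]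
    · have htf : G ![true, false] = 0 := by simpa [hff, hft] using h.symm
      refine ⟨fun a => G ![a, true], fun b => if b then 1 else 0, forall_fin_two_bool ?_ ?_ ?_ ?_⟩
        <;> simp [hff, htf]
  · refine ⟨fun a => G ![a, false], fun b => G ![false, b] / G ![false, false],
      forall_fin_two_bool ?_ ?_ ?_ ?_⟩
    · simp [hff]
    · simp [mul_div_cancel₀, hff]
    · simp [hff]
    · simp only [Matrix.cons_val_zero, Matrix.cons_val_one]
      field_simp
      rw [mul_comm, h, mul_comm]

/-- Remark (incomparability of `⟨NEQ, ℬ₁⟩_ω` and `⟨IMP, ℬ₁⟩_ω`), together with the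
normal form of binary functions in `⟨NEQ, ℬ₁⟩_ω`. -/
theorem neq_imp_incomparable :
    NEQfn ∉ CloneOmega ℝ≥0 ({IMPfn} ∪ unaryFns) ∧
    IMPfn ∉ CloneOmega ℝ≥0 ({NEQfn} ∪ unaryFns) ∧
    ¬ CloneOmega ℝ≥0 ({NEQfn} ∪ unaryFns) ⊆ CloneOmega ℝ≥0 ({IMPfn} ∪ unaryFns) ∧
    ¬ CloneOmega ℝ≥0 ({IMPfn} ∪ unaryFns) ⊆ CloneOmega ℝ≥0 ({NEQfn} ∪ unaryFns) ∧
    ∀ G : FnOn ℝ≥0 2, (⟨2, G⟩ : Fn ℝ≥0) ∈ CloneOmega ℝ≥0 ({NEQfn} ∪ unaryFns) →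
      (∃ U₁ U₂ : Bool → ℝ≥0, ∀ x, G x = U₁ (x 0) * U₂ (x 1)) ∨
      (∃ U : Bool → ℝ≥0, ∀ x, G x = U (x 0) * (if x 0 = x 1 then 1 else 0)) ∨
      (∃ U : Bool → ℝ≥0, ∀ x, G x = U (x 0) * (if x 0 ≠ x 1 then 1 else 0)) := by
  refine ⟨NEQfn_notMem_cloneOmega_IMPfn, IMPfn_notMem_cloneOmega_NEQfn,
    fun h => NEQfn_notMem_cloneOmega_IMPfn (h (mem_cloneOmega_of_mem (by simp))),
    fun h => IMPfn_notMem_cloneOmega_NEQfn (h (mem_cloneOmega_of_mem (by simp))),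
    fun G hG => ?_⟩
  rcases singularOrMonomial_of_mem_cloneOmega_NEQfn hG with h | ⟨h₁, h₂⟩ | ⟨h₁, h₂⟩
  · exact Or.inl (exists_eq_mul_of_singular h)
  · refine Or.inr (Or.inl ⟨fun a => G ![a, a], forall_fin_two_bool ?_ ?_ ?_ ?_⟩) <;> simp [h₁, h₂]
  · refine Or.inr (Or.inr ⟨fun a => G ![a, !a], forall_fin_two_bool ?_ ?_ ?_ ?_⟩) <;>
      simp [h₁, h₂]
end

section
/- The pps_ω-definable functional clone ⟨OR, ℬ₁⟩_ω equals ℬ, the set of all functions F : {0,1}^n → ℝ≥0 of all arities n. -/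
open scoped NNReal BigOperators

open Filter Topology

/-- `PpsRep` with free variables, bound variables and atomic formulas indexed by arbitrary
(finite, except for the free variables) types. -/
def GenRep (R : Type) [CommSemiring R] (𝓕 : Set (Fn R)) {α : Type} (F : (α → Bool) → R) : Prop :=
  ∃ (β ι : Type) (_ : Fintype β) (_ : DecidableEq β) (_ : Fintype ι) (G : ι → Fn R)
    (σ : (j : ι) → Fin (G j).1 → α ⊕ β),
    (∀ j, G j ∈ 𝓕) ∧
    ∀ x : α → Bool, F x = ∑ y : β → Bool, ∏ j : ι, (G j).2 (fun i => Sum.elim x y (σ j i))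

namespace GenRep

section Semiring

variable {R : Type} [CommSemiring R] {𝓕 : Set (Fn R)} {α : Type}

theorem mono {𝓖 : Set (Fn R)} (h : 𝓕 ⊆ 𝓖) {F : (α → Bool) → R} (hF : GenRep R 𝓕 F) :
    GenRep R 𝓖 F := by
  obtain ⟨β, ι, _, _, _, G, σ, hG, hs⟩ := hF
  exact ⟨β, ι, _, _, _, G, σ, fun j => h (hG j), hs⟩

theorem exists_finite {F : (α → Bool) → R} (hF : GenRep R 𝓕 F) :
    ∃ S ⊆ 𝓕, S.Finite ∧ GenRep R S F := by
  obtain ⟨β, ι, _, _, _, G, σ, hG, hs⟩ := hF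
  exact ⟨Set.range G, Set.range_subset_iff.2 hG, Set.finite_range G,
    β, ι, _, _, _, G, σ, fun j => ⟨j, rfl⟩, hs⟩

theorem ppsRep {n : ℕ} {F : FnOn R n} (hF : GenRep R 𝓕 F) : PpsRep R 𝓕 F := by
  obtain ⟨β, ι, _, _, _, G, σ, hG, hs⟩ := hF
  let eβ := Fintype.equivFin β
  let eι := Fintype.equivFin ι
  refine ⟨Fintype.card β, Fintype.card ι, fun j => G (eι.symm j),
    fun j i => finSumFinEquiv (Sum.map id eβ (σ (eι.symm j) i)), fun j => hG _, fun x => ?_⟩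
  rw [hs x]
  refine Fintype.sum_equiv (eβ.arrowCongr (Equiv.refl Bool)) _ _ fun y => ?_
  refine Fintype.prod_equiv eι _ _ fun j => ?_
  have key : ∀ s : Fin n ⊕ β, Fin.append x (eβ.arrowCongr (Equiv.refl Bool) y)
      (finSumFinEquiv (Sum.map id eβ s)) = Sum.elim x y s := by
    rintro (a | b) <;> simp [Equiv.arrowCongr]
  simp only [key]
  rw [eι.symm_apply_apply]

theorem atom {G : Fn R} (hG : G ∈ 𝓕) (σ : Fin G.1 → α) :
    GenRep R 𝓕 (fun x : α → Bool => G.2 (fun i => x (σ i))) :=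
  ⟨Empty, Unit, inferInstance, inferInstance, inferInstance, fun _ => G,
    fun _ i => Sum.inl (σ i), fun _ => hG, fun x => by simp⟩

theorem one : GenRep R 𝓕 (fun _ : α → Bool => (1 : R)) :=
  ⟨Empty, Empty, inferInstance, inferInstance, inferInstance, fun j => j.elim,
    fun j => j.elim, fun j => j.elim, fun x => by simp⟩

theorem mul {F F' : (α → Bool) → R} (hF : GenRep R 𝓕 F) (hF' : GenRep R 𝓕 F') :
    GenRep R 𝓕 (fun x => F x * F' x) := by
  obtain ⟨β, ι, _, _, _, G, σ, hG, hs⟩ := hF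
  obtain ⟨β', ι', _, _, _, G', σ', hG', hs'⟩ := hF'
  refine ⟨β ⊕ β', ι ⊕ ι', inferInstance, inferInstance, inferInstance, Sum.elim G G',
    Sum.rec (fun j i => Sum.map id Sum.inl (σ j i)) (fun j i => Sum.map id Sum.inr (σ' j i)),
    Sum.rec hG hG', fun x => ?_⟩
  have h : F x * F' x = ∑ p : (β → Bool) × (β' → Bool),
      (∏ j, (G j).2 (fun i => Sum.elim x p.1 (σ j i))) *
        ∏ j, (G' j).2 (fun i => Sum.elim x p.2 (σ' j i)) := by
    rw [hs, hs', Fintype.sum_mul_sum, ← Fintype.sum_prod_type']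
  refine h.trans (Fintype.sum_equiv (Equiv.sumArrowEquivProdArrow β β' Bool) _ _ fun y => ?_).symm
  refine (Fintype.prod_sum_type _).trans ?_
  have key : ∀ s : α ⊕ β, Sum.elim x y (Sum.map id Sum.inl s) =
      Sum.elim x (y ∘ Sum.inl) s := by
    rintro (a | b) <;> rfl
  have key' : ∀ s : α ⊕ β', Sum.elim x y (Sum.map id Sum.inr s) =
      Sum.elim x (y ∘ Sum.inr) s := by
    rintro (a | b) <;> rfl
  exact congrArg₂ (· * ·)
    (Finset.prod_congr rfl fun j _ => congrArg (G j).2 (funext fun i => key _))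
    (Finset.prod_congr rfl fun j _ => congrArg (G' j).2 (funext fun i => key' _))

theorem prod {κ : Type} (s : Finset κ) {F : κ → (α → Bool) → R}
    (hF : ∀ k, GenRep R 𝓕 (F k)) : GenRep R 𝓕 (fun x => ∏ k ∈ s, F k x) := by
  classical
  induction s using Finset.induction_on with
  | empty => simpa using one
  | insert a s ha ih =>
    simp only [Finset.prod_insert ha]
    exact (hF a).mul ih

theorem pow {F : (α → Bool) → R} (hF : GenRep R 𝓕 F) (k : ℕ) :
    GenRep R 𝓕 (fun x => F x ^ k) := by
  simpa using prod (Finset.range k) fun _ => hF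

theorem sum {γ : Type} [Fintype γ] [DecidableEq γ] {F : (α ⊕ γ → Bool) → R}
    (hF : GenRep R 𝓕 F) : GenRep R 𝓕 (fun x => ∑ z : γ → Bool, F (Sum.elim x z)) := by
  obtain ⟨β, ι, _, _, _, G, σ, hG, hs⟩ := hF
  refine ⟨γ ⊕ β, ι, inferInstance, inferInstance, inferInstance, G,
    fun j i => Equiv.sumAssoc α γ β (σ j i), hG, fun x => ?_⟩
  simp only [hs]
  rw [← Fintype.sum_prod_type']
  refine (Fintype.sum_equiv (Equiv.sumArrowEquivProdArrow γ β Bool) _ _ fun y => ?_).symm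
  have key : ∀ s : (α ⊕ γ) ⊕ β, Sum.elim x y (Equiv.sumAssoc α γ β s) =
      Sum.elim (Sum.elim x (y ∘ Sum.inl)) (y ∘ Sum.inr) s := by
    rintro ((a | b) | c) <;> rfl
  simp only [key]
  rfl

theorem add_bool {F : Bool → (α → Bool) → R}
    (hF : GenRep R 𝓕 (fun x : α ⊕ Unit → Bool => F (x (Sum.inr ())) (fun a => x (Sum.inl a)))) :
    GenRep R 𝓕 (fun x => F true x + F false x) := by
  convert hF.sum using 2 with x
  rw [← (Equiv.funUnique Unit Bool).symm.sum_comp]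
  simp

end Semiring

/-- `OR` as a function of two Boolean arguments. -/
def orVal (p q : Bool) : ℝ≥0 := if p = false ∧ q = false then 0 else 1

/-- Three `OR`s in series, scaled by a unary weight so that the value is `1` on unequal
arguments and less than `1` on equal ones. -/
noncomputable def softNeq (p q : Bool) : ℝ≥0 :=
  (if p then 5 / 9 else 9 / 10) * (if q then 5 / 9 else 9 / 10) *
    (if p then (if q then 3 else 2) else (if q then 2 else 1))

theorem softNeq_not (p : Bool) : softNeq p (!p) = 1 := by
  cases p <;> simp only [softNeq, Bool.not_true, Bool.not_false, if_true, if_false,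
    Bool.false_eq_true] <;> (apply NNReal.eq; push_cast; norm_num)

theorem softNeq_self_lt (p : Bool) : softNeq p p < 1 := by
  cases p <;> simp only [softNeq, if_true, if_false, Bool.false_eq_true] <;>
    (rw [← NNReal.coe_lt_coe]; push_cast; norm_num)

theorem softNeq_le_one (p q : Bool) : softNeq p q ≤ 1 := by
  by_cases h : q = !p
  · rw [h, softNeq_not]
  · have : q = p := by cases p <;> cases q <;> simp_all
    rw [this]
    exact (softNeq_self_lt p).le

theorem prod_softNeq_lt_one {n : ℕ} {x y : Fin n → Bool} (h : y ≠ fun i => !x i) :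
    ∏ i, softNeq (x i) (y i) < 1 := by
  obtain ⟨i, hi⟩ := Function.ne_iff.1 h
  have hxy : y i = x i := by revert hi; cases x i <;> cases y i <;> simp
  rw [← Finset.mul_prod_erase _ _ (Finset.mem_univ i), hxy]
  calc softNeq (x i) (x i) * ∏ j ∈ Finset.univ.erase i, softNeq (x j) (y j)
      ≤ softNeq (x i) (x i) * 1 := by
        gcongr
        exact Finset.prod_le_one' fun j _ => softNeq_le_one _ _
    _ < 1 := by simpa using softNeq_self_lt (x i)

/-- The generators `OR`, `EQ` and all unary functions. -/
def gens : Set (Fn ℝ≥0) := ({ORfn} ∪ unaryFns) ∪ {EQfn ℝ≥0}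

variable {α : Type}

theorem or (a b : α) : GenRep ℝ≥0 gens (fun x => orVal (x a) (x b)) := by
  simpa [ORfn, orVal] using atom (𝓕 := gens) (G := ORfn) (by simp [gens]) ![a, b]

theorem unary (u : Bool → ℝ≥0) (a : α) : GenRep ℝ≥0 gens (fun x => u (x a)) :=
  atom (𝓕 := gens) (G := ⟨1, fun x => u (x 0)⟩) (by simp [gens, unaryFns]) fun _ => a

theorem const (c : ℝ≥0) : GenRep ℝ≥0 gens (fun _ : α → Bool => c) := by
  simpa using add_bool (F := fun _ _ => c / 2) (unary (fun _ => c / 2) (Sum.inr ()))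

theorem neq (a b : α) : GenRep ℝ≥0 gens (fun x => softNeq (x a) (x b)) := by
  have h : GenRep ℝ≥0 gens (fun x : α → Bool =>
      (orVal (x a) true * (orVal true true * orVal true (x b) +
        orVal true false * orVal false (x b))) +
      (orVal (x a) false * (orVal false true * orVal true (x b) +
        orVal false false * orVal false (x b)))) := by
    refine add_bool (F := fun p x => orVal (x a) p * (orVal p true * orVal true (x b) +
        orVal p false * orVal false (x b))) ?_
    refine (or (Sum.inl a) (Sum.inr ())).mul ?_
    refine add_bool (F := fun q (x : α ⊕ Unit → Bool) =>
      orVal (x (Sum.inr ())) q * orVal q (x (Sum.inl b))) ?_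
    exact (or (Sum.inl (Sum.inr ())) (Sum.inr ())).mul (or (Sum.inr ()) (Sum.inl (Sum.inl b)))
  have hu := unary (α := α) (fun p => if p then 5 / 9 else 9 / 10)
  convert ((hu a).mul (hu b)).mul h using 2 with x
  unfold softNeq
  congr 1
  cases x a <;> cases x b <;> simp [orVal] <;> norm_num

theorem gate {n : ℕ} (l : Fin n → α) (t : ℝ≥0) :
    GenRep ℝ≥0 gens (fun x => 1 + if ∀ i, x (l i) = true then t else 0) := by
  have h := add_bool (F := fun z (x : α → Bool) =>
      (if z then 1 else t) * ∏ i, orVal z (x (l i)))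
    ((unary (fun z => if z then 1 else t) (Sum.inr ())).mul
      (prod Finset.univ fun i => or (Sum.inr ()) (Sum.inl (l i))))
  convert h using 2 with x
  congr 1
  · simp [orVal]
  · by_cases hx : ∀ i, x (l i) = true
    · simp [orVal, hx]
    · obtain ⟨i, hi⟩ := not_forall.1 hx
      rw [if_neg hx, Finset.prod_eq_zero (Finset.mem_univ i), mul_zero]
      simpa [orVal] using hi

/-- A product of gates, one for each Boolean vector `a`; the right-hand copy of the variables
plays the role of the negated variables. -/
def table {n : ℕ} (t : (Fin n → Bool) → ℝ≥0) (v : Fin n ⊕ Fin n → Bool) : ℝ≥0 :=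
  ∏ a : Fin n → Bool,
    (1 + if ∀ i, v (if a i then Sum.inl i else Sum.inr i) = true then t a else 0)

theorem table_rep {n : ℕ} (t : (Fin n → Bool) → ℝ≥0) : GenRep ℝ≥0 gens (table t) :=
  prod Finset.univ fun a => gate (fun i => if a i then Sum.inl i else Sum.inr i) (t a)

theorem table_not {n : ℕ} (t : (Fin n → Bool) → ℝ≥0) (x : Fin n → Bool) :
    table t (Sum.elim x fun i => !x i) = 1 + t x := by
  have key : ∀ a : Fin n → Bool, (∀ i, (Sum.elim x fun i => !x i)
      (if a i then Sum.inl i else Sum.inr i) = true) ↔ a = x := by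
    intro a
    rw [funext_iff]
    refine forall_congr' fun i => ?_
    cases a i <;> cases hx : x i <;> simp [hx]
  unfold table
  rw [Finset.prod_eq_single x]
  · rw [if_pos ((key x).2 rfl)]
  · intro a _ ha
    rw [if_neg (mt (key a).1 ha), add_zero]
  · simp

/-- Powers of a function bounded by `1` select a subset of the assignments to the bound
variables, in the limit. -/
theorem mem_cloneOmega_of_pow {n : ℕ} {𝓕 : Set (Fn ℝ≥0)} {F : FnOn ℝ≥0 n} {γ : Type}
    [Fintype γ] [DecidableEq γ] {G K : (Fin n ⊕ γ → Bool) → ℝ≥0}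
    (hG : GenRep ℝ≥0 (𝓕 ∪ {EQfn ℝ≥0}) G) (hK : GenRep ℝ≥0 (𝓕 ∪ {EQfn ℝ≥0}) K)
    (hF : ∀ x, Tendsto (fun k : ℕ => ∑ y : γ → Bool, G (Sum.elim x y) * K (Sum.elim x y) ^ k)
      atTop (𝓝 (F x))) :
    (⟨n, F⟩ : Fn ℝ≥0) ∈ CloneOmega ℝ≥0 𝓕 := by
  obtain ⟨S, hS, hSf, hGS⟩ := hG.exists_finite
  obtain ⟨T, hT, hTf, hKT⟩ := hK.exists_finite
  refine ⟨S ∪ T, Set.union_subset hS hT, hSf.union hTf, fun ε hε => ?_⟩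
  obtain ⟨k, hk⟩ := (eventually_all.2 fun x => Metric.tendsto_nhds.1 (hF x) ε hε).exists
  exact ⟨_, (((hGS.mono Set.subset_union_left).mul
    ((hKT.mono Set.subset_union_right).pow k)).sum).ppsRep, hk⟩

theorem mem_cloneOmega {n : ℕ} (F : FnOn ℝ≥0 n) :
    (⟨n, F⟩ : Fn ℝ≥0) ∈ CloneOmega ℝ≥0 ({ORfn} ∪ unaryFns) := by
  obtain ⟨c, hc, hcF⟩ : ∃ c : ℝ≥0, 0 < c ∧ ∀ x, F x ≠ 0 → c ≤ F x := by
    obtain ⟨x₀, hx₀⟩ := Finite.exists_min fun x => if F x = 0 then 1 else F x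
    refine ⟨if F x₀ = 0 then 1 else F x₀, ?_, fun x hx => by simpa [hx] using hx₀ x⟩
    split_ifs with h
    exacts [one_pos, pos_iff_ne_zero.2 h]
  let M : (Fin n ⊕ Fin n → Bool) → ℝ≥0 := fun v => ∏ i, softNeq (v (Sum.inl i)) (v (Sum.inr i))
  let H : (Fin n ⊕ Fin n → Bool) → ℝ≥0 := table fun a => if F a = 0 then 0 else 1
  have hM : GenRep ℝ≥0 gens M := prod Finset.univ fun i => neq (Sum.inl i) (Sum.inr i)
  obtain ⟨L, hL⟩ : ∃ L : ℕ, ∀ v, M v < 1 → M v ^ L * (H v * (1 / 2)) < 1 := by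
    refine (eventually_all (l := atTop).2 fun v => ?_).exists
    by_cases hv : M v < 1
    · have := (NNReal.tendsto_pow_atTop_nhds_zero_of_lt_one hv).mul_const (H v * (1 / 2))
      rw [zero_mul] at this
      filter_upwards [this.eventually_lt_const one_pos] with k hk _ using hk
    · exact Eventually.of_forall fun _ h => absurd h hv
  refine mem_cloneOmega_of_pow (γ := Fin n) ((const c).mul (table_rep fun a => F a / c - 1))
    ((hM.pow L).mul ((table_rep fun a => if F a = 0 then 0 else 1).mul (const (1 / 2)))) fun x => ?_
  have hsum : F x = ∑ y : Fin n → Bool, if y = (fun i => !x i) then F x else 0 := by simp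
  rw [hsum]
  refine tendsto_finsetSum _ fun y _ => ?_
  have hzero : ∀ (g : ℝ≥0) {r : ℝ≥0}, r < 1 → Tendsto (fun k : ℕ => g * r ^ k) atTop (𝓝 0) :=
    fun g r hr => by
      simpa using (NNReal.tendsto_pow_atTop_nhds_zero_of_lt_one hr).const_mul g
  by_cases hy : y = fun i => !x i
  · subst hy
    have hM1 : M (Sum.elim x fun i => !x i) = 1 := by simp [M, softNeq_not]
    simp only [hM1, if_true, table_not, one_pow, one_mul]
    by_cases hx : F x = 0
    · rw [hx]
      refine hzero _ ?_
      rw [if_pos rfl, add_zero, one_mul]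
      exact NNReal.half_lt_self one_ne_zero
    · have h1 : (1 : ℝ≥0) ≤ F x / c := (one_le_div hc).2 (hcF x hx)
      have h2 : ((1 : ℝ≥0) + 1) * (1 / 2) = 1 := by norm_num
      rw [if_neg hx, h2, add_tsub_cancel_of_le h1, mul_div_cancel₀ _ hc.ne']
      simp
  · rw [if_neg hy]
    exact hzero _ (hL _ (prod_softNeq_lt_one hy))

end GenRep

/-- Lemma (`OR` clone): `⟨OR, ℬ₁⟩_ω` consists of all nonnegative functions. -/
theorem cloneOmega_or_eq_univ :
    CloneOmega ℝ≥0 ({ORfn} ∪ unaryFns) = Set.univ := by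
  exact Set.eq_univ_of_forall fun ⟨_, F⟩ => GenRep.mem_cloneOmega F
end

section
/- Let y ∈ {0,1}^n and let t ∈ ℝ, with t ≥ 0 if |y| > 1 (where |y| = Σ_i y_i). Define F : {0,1}^n → ℝ>0 by F(x) = e^t if y ≤ x (componentwise) and F(x) = 1 otherwise. Then F belongs to the functional clone ⟨LSM₂⟩. -/
open scoped NNReal BigOperators

/-- `LSM_k`: the log-supermodular functions of arity `k`. -/
def LSMk (k : ℕ) : Set (Fn ℝ≥0) := {F | F.1 = k ∧ IsLSM F.2}

/-- The binary function with values `g a b` is a member of `LSM₂` when `g` is lsm. -/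
theorem mem_lsmk_two {g : Bool → Bool → ℝ≥0}
    (hg : ∀ a b c d, g a b * g c d ≤ g (a ⊔ c) (b ⊔ d) * g (a ⊓ c) (b ⊓ d)) :
    (⟨2, fun x => g (x 0) (x 1)⟩ : Fn ℝ≥0) ∈ LSMk 2 :=
  ⟨rfl, fun x y => hg (x 0) (x 1) (y 0) (y 1)⟩

/-- Sums of products of binary lsm functions applied to pairs of variables belong to `⟨LSM₂⟩`. -/
theorem mem_clone_lsm2_of_binary {n : ℕ} (F : FnOn ℝ≥0 n) (m s : ℕ)
    (g : Fin s → Bool → Bool → ℝ≥0) (p q : Fin s → Fin (n + m))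
    (hg : ∀ j a b c d, g j a b * g j c d ≤ g j (a ⊔ c) (b ⊔ d) * g j (a ⊓ c) (b ⊓ d))
    (hF : ∀ x, F x = ∑ z : Fin m → Bool,
      ∏ j, g j (Fin.append x z (p j)) (Fin.append x z (q j))) :
    (⟨n, F⟩ : Fn ℝ≥0) ∈ Clone ℝ≥0 (LSMk 2) :=
  ⟨m, s, fun j => ⟨2, fun x => g j (x 0) (x 1)⟩, fun j => ![p j, q j],
    fun j => Or.inl (mem_lsmk_two (hg j)), hF⟩

theorem sum_fin_one_bool {M : Type*} [AddCommMonoid M] (f : (Fin 1 → Bool) → M) :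
    ∑ z, f z = f (fun _ => true) + f (fun _ => false) := by
  rw [← Fintype.sum_bool fun b => f fun _ => b]
  exact Fintype.sum_equiv (Equiv.funUnique (Fin 1) Bool) _ _ fun z =>
    congrArg f (funext fun i => congrArg z (Subsingleton.elim _ _))

/-- With one bound variable `z` of weight `c - 1` at `1`, the implications `z → xᵢ` for `yᵢ = 1`
express the function equal to `c` above `y` and to `1` elsewhere. -/
theorem ite_le_mem_clone_lsm2_of_one_le {n : ℕ} (y : Fin n → Bool) {c : ℝ≥0} (hc : 1 ≤ c) :
    (⟨n, fun x => if ∀ i, y i ≤ x i then c else 1⟩ : Fn ℝ≥0) ∈ Clone ℝ≥0 (LSMk 2) := by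
  refine mem_clone_lsm2_of_binary _ 1 (n + 1)
    (Fin.cons (fun a _ => if a then c - 1 else 1) fun i a b =>
      if a = true → y i ≤ b then 1 else 0)
    (fun _ => Fin.natAdd n 0) (Fin.cons (Fin.natAdd n 0) fun i => Fin.castAdd 1 i) ?_ ?_
  · intro j
    refine Fin.cases ?_ (fun i => ?_) j
    · intro a _ b _
      cases a <;> cases b <;> simp
    · cases hy : y i <;> intro a b a' b' <;> cases a <;> cases b <;> cases a' <;> cases b' <;>
        simp [hy, Bool.le_iff_imp]
  · intro x
    rw [sum_fin_one_bool]
    simp only [Fin.prod_univ_succ, Fin.cons_zero, Fin.cons_succ, Fin.append_left, Fin.append_right]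
    by_cases h : ∀ i, y i ≤ x i
    · simp [h, tsub_add_cancel_of_le hc]
    · obtain ⟨i, hi⟩ := not_forall.1 h
      have h0 : ∏ i, (if y i ≤ x i then (1 : ℝ≥0) else 0) = 0 :=
        Finset.prod_eq_zero (Finset.mem_univ i) (if_neg hi)
      simp [h, h0]

theorem const_mem_clone_lsm2 (n : ℕ) (c : ℝ≥0) :
    (⟨n, fun _ => c⟩ : Fn ℝ≥0) ∈ Clone ℝ≥0 (LSMk 2) :=
  mem_clone_lsm2_of_binary _ 1 1 (fun _ _ _ => c / 2) (fun _ => Fin.natAdd n 0)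
    (fun _ => Fin.natAdd n 0) (fun _ _ _ _ _ => le_rfl) fun _ => by rw [sum_fin_one_bool]; simp

theorem unary_mem_clone_lsm2 {n : ℕ} (u : Bool → ℝ≥0) (i : Fin n) :
    (⟨n, fun x => u (x i)⟩ : Fn ℝ≥0) ∈ Clone ℝ≥0 (LSMk 2) := by
  refine mem_clone_lsm2_of_binary _ 0 1 (fun _ a _ => u a) (fun _ => Fin.castAdd 0 i)
    (fun _ => Fin.castAdd 0 i) (fun _ a _ b _ => ?_) fun x => ?_
  · cases a <;> cases b <;> simp [mul_comm]
  · simp only [Fin.append_left]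
    simp

/-- Lemma (`chi`): for `y ∈ {0,1}^n` and `t ∈ ℝ` with `t ≥ 0` whenever `|y| > 1`, the
function `F(x) = e^t` if `y ≤ x` and `F(x) = 1` otherwise belongs to `⟨LSM₂⟩`. -/
theorem chi_mem_clone_lsm2 (n : ℕ) (y : Fin n → Bool) (t : ℝ)
    (ht : 1 < (Finset.univ.filter fun i => y i = true).card → 0 ≤ t) :
    (⟨n, fun x => if ∀ i, y i ≤ x i then Real.toNNReal (Real.exp t) else 1⟩ : Fn ℝ≥0) ∈
      Clone ℝ≥0 (LSMk 2) := by
  by_cases hcard : 1 < (Finset.univ.filter fun i => y i = true).card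
  · exact ite_le_mem_clone_lsm2_of_one_le y
      (Real.one_le_toNNReal.2 (Real.one_le_exp (ht hcard)))
  · have hsub := Finset.card_le_one.1 (not_lt.1 hcard)
    simp only [Finset.mem_filter, Finset.mem_univ, true_and] at hsub
    by_cases hy : ∃ i, y i = true
    · obtain ⟨i, hi⟩ := hy
      have hiff : ∀ x : Fin n → Bool, (∀ j, y j ≤ x j) ↔ x i = true := by
        refine fun x => ⟨fun h => h i hi, fun h j hj => ?_⟩
        rwa [hsub j hj i hi]
      simp only [hiff]
      exact unary_mem_clone_lsm2 (fun b => if b = true then Real.toNNReal (Real.exp t) else 1) i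
    · have hle : ∀ x : Fin n → Bool, ∀ j, y j ≤ x j := fun x j hj => (hy ⟨j, hj⟩).elim
      simp only [hle, implies_true, if_true]
      exact const_mem_clone_lsm2 n _
end

section
/- The functional clone generated by the log-supermodular functions of arity 3 equals the functional clone generated by the log-supermodular functions of arity 2: ⟨LSM₃⟩ = ⟨LSM₂⟩. -/
open scoped NNReal BigOperators

/-- Pps-formulas may be indexed by arbitrary finite types of bound variables and atoms. -/
theorem ppsRep_of_fintype {R : Type} [CommSemiring R] {𝓖 : Set (Fn R)} {n : ℕ} {F : FnOn R n}
    {κ ι : Type} [Fintype κ] [DecidableEq κ] [Fintype ι] (G : ι → Fn R)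
    (σ : (j : ι) → Fin (G j).1 → Fin n ⊕ κ) (hG : ∀ j, G j ∈ 𝓖)
    (hF : ∀ x, F x = ∑ y : κ → Bool, ∏ j, (G j).2 (fun i => Sum.elim x y (σ j i))) :
    PpsRep R 𝓖 F := by
  let e := Fintype.equivFin κ
  let e' := (Fintype.equivFin ι).symm
  refine ⟨Fintype.card κ, Fintype.card ι, fun j => G (e' j),
    fun j i => finSumFinEquiv (Sum.map id e (σ (e' j) i)), fun j => hG _, fun x => ?_⟩
  rw [hF]
  refine Fintype.sum_equiv (e.arrowCongr (Equiv.refl Bool)) _ _ fun y => ?_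
  refine Fintype.prod_equiv e'.symm _ _ fun j => ?_
  obtain ⟨j, rfl⟩ := e'.surjective j
  rw [Equiv.symm_apply_apply]
  refine congrArg (G (e' j)).2 (funext fun i => ?_)
  change Sum.elim x y (σ (e' j) i) =
    Fin.append x (y ∘ e.symm) (finSumFinEquiv (Sum.map id e (σ (e' j) i)))
  rcases σ (e' j) i with a | b <;> simp

/-- Substituting representations for the atoms of a pps-formula. -/
theorem PpsRep.trans {R : Type} [CommSemiring R] {𝓕 𝓖 : Set (Fn R)} {n : ℕ} {F : FnOn R n}
    (hF : PpsRep R 𝓕 F) (h : ∀ G ∈ 𝓕, PpsRep R 𝓖 G.2) : PpsRep R 𝓖 F := by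
  obtain ⟨m, s, G, σ, hG, hF⟩ := hF
  choose m' s' G' σ' hG' hF' using fun j => h (G j) (hG j)
  refine ppsRep_of_fintype (κ := Fin m ⊕ Σ j, Fin (m' j)) (ι := Σ j, Fin (s' j))
    (fun p => G' p.1 p.2)
    (fun p i => Sum.elim (fun a => Sum.map id Sum.inl (finSumFinEquiv.symm (σ p.1 a)))
      (fun b => Sum.inr (Sum.inr ⟨p.1, b⟩)) (finSumFinEquiv.symm (σ' p.1 p.2 i)))
    (fun p => hG' _ _) fun x => ?_
  rw [hF]
  simp_rw [hF', Finset.prod_univ_sum, Fintype.piFinset_univ]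
  rw [← Fintype.sum_prod_type']
  refine Fintype.sum_equiv (((Equiv.refl _).prodCongr
    (Equiv.piCurry fun _ _ => Bool).symm).trans (Equiv.sumArrowEquivProdArrow _ _ _).symm) _ _ ?_
  rintro ⟨y, z⟩
  rw [Fintype.prod_sigma]
  refine Finset.prod_congr rfl fun j _ => Finset.prod_congr rfl fun k _ => ?_
  refine congrArg (G' j k).2 (funext fun i => ?_)
  obtain ⟨t, ht⟩ := finSumFinEquiv.surjective (σ' j k i)
  rw [← ht, Equiv.symm_apply_apply]
  rcases t with a | b
  · obtain ⟨u, hu⟩ := finSumFinEquiv.surjective (σ j a)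
    simp only [finSumFinEquiv_apply_left, Fin.append_left, Sum.elim_inl]
    rw [← hu, Equiv.symm_apply_apply]
    rcases u with c | d <;> simp [Equiv.sumArrowEquivProdArrow]
  · simp [Equiv.sumArrowEquivProdArrow, Sigma.uncurry]

theorem ppsRep_of_mem {R : Type} [CommSemiring R] {𝓕 : Set (Fn R)} {G : Fn R} (hG : G ∈ 𝓕) :
    PpsRep R 𝓕 G.2 :=
  ppsRep_of_fintype (κ := Empty) (ι := Unit) (fun _ => G) (fun _ => Sum.inl) (fun _ => hG)
    fun x => by simp

/-- Log-supermodularity of a binary function, in curried form. -/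
def BinLSM (g : Bool → Bool → ℝ≥0) : Prop :=
  g true false * g false true ≤ g true true * g false false

theorem BinLSM.mul {g h : Bool → Bool → ℝ≥0} (hg : BinLSM g) (hh : BinLSM h) :
    BinLSM fun a b => g a b * h a b := by
  have := mul_le_mul' hg hh
  unfold BinLSM
  calc _ = _ := by ring
    _ ≤ _ := this
    _ = _ := by ring

theorem BinLSM.compl {g : Bool → Bool → ℝ≥0} (hg : BinLSM g) :
    BinLSM fun a b => g (!a) (!b) := by
  simpa [BinLSM, mul_comm] using hg

theorem BinLSM.mem_LSMk {g : Bool → Bool → ℝ≥0} (hg : BinLSM g) :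
    (⟨2, fun x => g (x 0) (x 1)⟩ : Fn ℝ≥0) ∈ LSMk 2 := by
  refine ⟨rfl, fun x y => ?_⟩
  unfold BinLSM at hg
  have h' := hg
  rw [mul_comm] at h'
  simp only [Pi.sup_apply, Pi.inf_apply]
  generalize x 0 = a, x 1 = b, y 0 = c, y 1 = d
  cases a <;> cases b <;> cases c <;> cases d <;> simp <;>
    first
      | exact hg
      | exact h'
      | exact (mul_comm _ _).le

/-- `f` is a product of three binary lsm functions of its arguments and a sum over one bound
variable of a product of three binary lsm functions linking it to the arguments. -/
def HasGadget (f : Bool → Bool → Bool → ℝ≥0) : Prop :=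
  ∃ p q r s t u : Bool → Bool → ℝ≥0,
    (BinLSM p ∧ BinLSM q ∧ BinLSM r ∧ BinLSM s ∧ BinLSM t ∧ BinLSM u) ∧
    ∀ a b c, f a b c = p a b * q a c * r b c * ∑ y, s a y * t b y * u c y

theorem HasGadget.compl {f : Bool → Bool → Bool → ℝ≥0}
    (h : HasGadget fun a b c => f (!a) (!b) (!c)) : HasGadget f := by
  obtain ⟨p, q, r, s, t, u, ⟨hp, hq, hr, hs, ht, hu⟩, h⟩ := h
  refine ⟨_, _, _, _, _, _, ⟨hp.compl, hq.compl, hr.compl, hs.compl, ht.compl, hu.compl⟩, ?_⟩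
  intro a b c
  have := h (!a) (!b) (!c)
  simp only [Bool.not_not] at this
  rw [this]
  simp [add_comm]

theorem hasGadget_of_pos_of_le {g : Bool → Bool → Bool → ℝ≥0} (pos : ∀ a b c, 0 < g a b c)
    (h₁₂ : g true false false * g false true false ≤ g true true false * g false false false)
    (h₁₃ : g true false false * g false false true ≤ g true false true * g false false false)
    (h₂₃ : g false true false * g false false true ≤ g false true true * g false false false)
    (h : g false false false * g true true false * g true false true * g false true true ≤
      g true true true * g true false false * g false true false * g false false true) :
    HasGadget g := by
  have ne : ∀ a b c, g a b c ≠ 0 := fun a b c => (pos a b c).ne'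
  set Q := g false false false * g true true false * g true false true * g false true true
    with hQ
  have Q0 : Q ≠ 0 := by simp [hQ, ne]
  obtain ⟨w, hw⟩ := exists_add_of_le h
  refine ⟨fun a b => g a b false, fun a c => g a false c / g a false false,
    fun b c => g false b c * g false false false / (g false b false * g false false c),
    fun a y => if y then (if a then w / Q else 0) else 1,
    fun b y => if y && !b then 0 else 1, fun c y => if y && !c then 0 else 1,
    ⟨h₁₂, ?_, ?_, ?_, ?_, ?_⟩, ?_⟩
  · simp only [BinLSM]
    rw [div_self (ne _ _ _), div_self (ne _ _ _), one_mul, mul_one, div_le_div_iff₀ (pos _ _ _)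
      (pos _ _ _), mul_comm]
    exact h₁₃
  · simp only [BinLSM]
    have e1 : g false true false * g false false false /
      (g false true false * g false false false) = 1 := div_self (by simp [ne])
    have e2 : g false false true * g false false false /
      (g false false false * g false false true) = 1 := by
        rw [mul_comm]; exact div_self (by simp [ne])
    have e3 : g false false false * g false false false /
      (g false false false * g false false false) = 1 := div_self (by simp [ne])
    rw [e1, e2, e3, mul_one, mul_one, one_le_div (by simp [pos])]
    exact h₂₃
  · simp [BinLSM]
  · simp [BinLSM]
  · simp [BinLSM]
  · have n0 := ne false false false
    have n1 := ne true false false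
    have n2 := ne false true false
    have n3 := ne false false true
    have n4 := ne true true false
    have n5 := ne true false true
    have n6 := ne false true true
    have last : g true true true = g true true false * (g true false true / g true false false) *
        (g false true true * g false false false / (g false true false * g false false true)) *
        (w / Q + 1) := by
      rw [div_add_one Q0, add_comm w Q, ← hw, hQ]
      field_simp
    intro a b c
    cases a <;> cases b <;> cases c <;> simp
    all_goals first | exact last | field_simp

/-- Ternary log-supermodularity in curried form. -/
def TernLSM (f : Bool → Bool → Bool → ℝ≥0) : Prop :=
  ∀ a b c a' b' c', f a b c * f a' b' c' ≤
    f (a ⊔ a') (b ⊔ b') (c ⊔ c') * f (a ⊓ a') (b ⊓ b') (c ⊓ c')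

theorem TernLSM.hasGadget_of_pos {g : Bool → Bool → Bool → ℝ≥0} (hg : TernLSM g)
    (pos : ∀ a b c, 0 < g a b c) : HasGadget g := by
  rcases le_total
    (g false false false * g true true false * g true false true * g false true true)
    (g true true true * g true false false * g false true false * g false false true) with h | h
  · exact hasGadget_of_pos_of_le pos (hg true false false false true false)
      (hg true false false false false true) (hg false true false false false true) h
  · refine HasGadget.compl (hasGadget_of_pos_of_le (fun a b c => pos _ _ _) ?_ ?_ ?_ ?_)
    · simpa [mul_comm] using hg false true true true false true
    · simpa [mul_comm] using hg false true true true true false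
    · simpa [mul_comm] using hg true false true true true false
    · simp only [Bool.not_true, Bool.not_false]
      calc _ = _ := by ring
        _ ≤ _ := h
        _ = _ := by ring

/-- The weight `ε ^ |a - b|`. -/
def flipWeight (ε : ℝ≥0) (a b : Bool) : ℝ≥0 := if a = b then 1 else ε

theorem flipWeight_mul_le {ε : ℝ≥0} (hε : ε ≤ 1) (a b a' b' : Bool) :
    flipWeight ε a b * flipWeight ε a' b' ≤
      flipWeight ε (a ⊔ a') (b ⊔ b') * flipWeight ε (a ⊓ a') (b ⊓ b') := by
  have : ε * ε ≤ 1 := mul_le_one' hε hε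
  cases a <;> cases b <;> cases a' <;> cases b' <;> simp [flipWeight, this]

/-- The function `x ↦ max_y F(y) ε ^ |x - y|`. -/
noncomputable def regularize (ε : ℝ≥0) (f : Bool → Bool → Bool → ℝ≥0) (a b c : Bool) : ℝ≥0 :=
  Finset.univ.sup fun y : Bool × Bool × Bool => f y.1 y.2.1 y.2.2 *
    (flipWeight ε a y.1 * flipWeight ε b y.2.1 * flipWeight ε c y.2.2)

theorem le_regularize (ε : ℝ≥0) (f : Bool → Bool → Bool → ℝ≥0) (a b c a' b' c' : Bool) :
    f a' b' c' * (flipWeight ε a a' * flipWeight ε b b' * flipWeight ε c c') ≤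
      regularize ε f a b c :=
  Finset.le_sup (f := fun y : Bool × Bool × Bool => f y.1 y.2.1 y.2.2 *
    (flipWeight ε a y.1 * flipWeight ε b y.2.1 * flipWeight ε c y.2.2))
    (Finset.mem_univ (a', b', c'))

theorem exists_eq_regularize (ε : ℝ≥0) (f : Bool → Bool → Bool → ℝ≥0) (a b c : Bool) :
    ∃ a' b' c', regularize ε f a b c =
      f a' b' c' * (flipWeight ε a a' * flipWeight ε b b' * flipWeight ε c c') := by
  obtain ⟨y, -, hy⟩ := Finset.exists_mem_eq_sup Finset.univ Finset.univ_nonempty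
    fun y : Bool × Bool × Bool => f y.1 y.2.1 y.2.2 *
      (flipWeight ε a y.1 * flipWeight ε b y.2.1 * flipWeight ε c y.2.2)
  exact ⟨y.1, y.2.1, y.2.2, hy⟩

theorem TernLSM.regularize {f : Bool → Bool → Bool → ℝ≥0} (hf : TernLSM f) {ε : ℝ≥0}
    (hε : ε ≤ 1) : TernLSM (regularize ε f) := by
  intro a b c a' b' c'
  obtain ⟨u, v, w, h⟩ := exists_eq_regularize ε f a b c
  obtain ⟨u', v', w', h'⟩ := exists_eq_regularize ε f a' b' c'
  rw [h, h']
  refine le_trans ?_ (mul_le_mul' (le_regularize ε f _ _ _ (u ⊔ u') (v ⊔ v') (w ⊔ w'))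
    (le_regularize ε f _ _ _ (u ⊓ u') (v ⊓ v') (w ⊓ w')))
  have := mul_le_mul' (hf u v w u' v' w') (mul_le_mul' (mul_le_mul'
    (flipWeight_mul_le hε a u a' u') (flipWeight_mul_le hε b v b' v'))
    (flipWeight_mul_le hε c w c' w'))
  calc _ = _ := by ring
    _ ≤ _ := this
    _ = _ := by ring

theorem exists_pos_mul_le {α : Type} [Fintype α] (f : α → ℝ≥0) :
    ∃ ε : ℝ≥0, 0 < ε ∧ ε ≤ 1 ∧ ∀ x y, f x ≠ 0 → f y * ε ≤ f x := by
  let δ : α × α → ℝ≥0 := fun z => if f z.1 ≠ 0 then f z.1 / (f z.1 + f z.2) else 1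
  have hδ : ∀ z, 0 < δ z ∧ δ z ≤ 1 := by
    intro z
    by_cases h : f z.1 = 0
    · simp [δ, h]
    · have h' := pos_iff_ne_zero.2 h
      simp only [δ, ne_eq, h, not_false_eq_true, if_true]
      exact ⟨div_pos h' (add_pos_of_pos_of_nonneg h' zero_le),
        div_le_one_of_le₀ le_self_add zero_le⟩
  refine ⟨∏ z, δ z, Finset.prod_pos fun z _ => (hδ z).1,
    Finset.prod_le_one' fun z _ => (hδ z).2, fun x y hx => ?_⟩
  have hle : ∏ z, δ z ≤ δ (x, y) := by
    classical
    rw [← Finset.mul_prod_erase _ _ (Finset.mem_univ (x, y))]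
    exact mul_le_of_le_one_right' (Finset.prod_le_one' fun z _ => (hδ z).2)
  have hx' := pos_iff_ne_zero.2 hx
  have hs : 0 < f x + f y := add_pos_of_pos_of_nonneg hx' zero_le
  calc f y * ∏ z, δ z ≤ (f x + f y) * δ (x, y) := mul_le_mul' le_add_self hle
    _ = f x := by
      simp only [δ, ne_eq, hx, not_false_eq_true, if_true]
      rw [mul_div_cancel₀ _ hs.ne']

theorem regularize_eq {f : Bool → Bool → Bool → ℝ≥0} {ε : ℝ≥0} (hε : ε ≤ 1)
    (h : ∀ a b c a' b' c', f a b c ≠ 0 → f a' b' c' * ε ≤ f a b c) {a b c : Bool}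
    (hf : f a b c ≠ 0) : regularize ε f a b c = f a b c := by
  refine le_antisymm (Finset.sup_le ?_) ?_
  · rintro ⟨a', b', c'⟩ -
    have w1 : ∀ u v, flipWeight ε u v ≤ 1 := fun u v => by
      unfold flipWeight; split_ifs <;> simp [hε]
    by_cases hy : a = a' ∧ b = b' ∧ c = c'
    · obtain ⟨rfl, rfl, rfl⟩ := hy
      simp [flipWeight]
    · refine le_trans (mul_le_mul_right ?_ _) (h a b c a' b' c' hf)
      by_cases ha : a = a'
      · by_cases hb : b = b'
        · have hc : c ≠ c' := fun hc => hy ⟨ha, hb, hc⟩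
          simp [flipWeight, ha, hb, hc]
        · calc _ ≤ 1 * ε * 1 := mul_le_mul' (mul_le_mul' (w1 _ _) (by simp [flipWeight, hb]))
                (w1 _ _)
            _ = ε := by simp
      · calc _ ≤ ε * 1 * 1 := mul_le_mul' (mul_le_mul' (by simp [flipWeight, ha]) (w1 _ _))
              (w1 _ _)
          _ = ε := by simp
  · simpa [flipWeight] using le_regularize ε f a b c a b c

theorem binLSM_indicator {P : Bool → Bool → Prop} [∀ a b, Decidable (P a b)]
    (h : ∀ a b a' b', P a b → P a' b' → P (a ⊔ a') (b ⊔ b') ∧ P (a ⊓ a') (b ⊓ b')) :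
    BinLSM fun a b => if P a b then 1 else 0 := by
  unfold BinLSM
  by_cases h1 : P true false
  · by_cases h2 : P false true
    · obtain ⟨h3, h4⟩ := h _ _ _ _ h1 h2
      simp only [Bool.max_eq_or, Bool.min_eq_and, Bool.or_false, Bool.or_true, Bool.and_false,
        Bool.and_true] at h3 h4
      simp [h1, h2, h3, h4]
    · simp [h2]
  · simp [h1]

theorem TernLSM.support {f : Bool → Bool → Bool → ℝ≥0} (hf : TernLSM f) {a b c a' b' c' : Bool}
    (h : f a b c ≠ 0) (h' : f a' b' c' ≠ 0) :
    f (a ⊔ a') (b ⊔ b') (c ⊔ c') ≠ 0 ∧ f (a ⊓ a') (b ⊓ b') (c ⊓ c') ≠ 0 := by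
  have := hf a b c a' b' c'
  rw [← not_or, ← mul_eq_zero]
  intro h0
  rw [h0, nonpos_iff_eq_zero, mul_eq_zero] at this
  tauto

theorem TernLSM.median {f : Bool → Bool → Bool → ℝ≥0} (hf : TernLSM f) {a b c a' b' c' : Bool}
    (h₁₂ : f a b c' ≠ 0) (h₁₃ : f a b' c ≠ 0) (h₂₃ : f a' b c ≠ 0) : f a b c ≠ 0 := by
  have := (hf.support (hf.support (hf.support h₁₂ h₁₃).2 (hf.support h₁₂ h₂₃).2).1
    (hf.support h₁₃ h₂₃).2).1
  cases a <;> cases b <;> cases c <;> simpa using this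

theorem TernLSM.hasGadget {f : Bool → Bool → Bool → ℝ≥0} (hf : TernLSM f) : HasGadget f := by
  classical
  by_cases hz : ∀ a b c, f a b c = 0
  · refine ⟨0, 0, 0, 0, 0, 0, by simp [BinLSM], fun a b c => by simp [hz]⟩
  push Not at hz
  obtain ⟨a₀, b₀, c₀, h₀⟩ := hz
  obtain ⟨ε, ε0, ε1, hε⟩ := exists_pos_mul_le fun y : Bool × Bool × Bool => f y.1 y.2.1 y.2.2
  have w0 : ∀ u v, 0 < flipWeight ε u v := fun u v => by
    unfold flipWeight; split_ifs <;> simp [ε0]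
  obtain ⟨p, q, r, s, t, u, ⟨hp, hq, hr, hs, ht, hu⟩, hg⟩ :=
    (hf.regularize ε1).hasGadget_of_pos fun a b c =>
      (mul_pos (pos_iff_ne_zero.2 h₀) (mul_pos (mul_pos (w0 _ _) (w0 _ _)) (w0 _ _))).trans_le
        (le_regularize ε f a b c a₀ b₀ c₀)
  have h₁₂ : BinLSM fun a b => if ∃ c, f a b c ≠ 0 then 1 else 0 := by
    refine binLSM_indicator ?_
    rintro a b a' b' ⟨c, h⟩ ⟨c', h'⟩
    exact ⟨⟨_, (hf.support h h').1⟩, ⟨_, (hf.support h h').2⟩⟩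
  have h₁₃ : BinLSM fun a c => if ∃ b, f a b c ≠ 0 then 1 else 0 := by
    refine binLSM_indicator ?_
    rintro a b a' b' ⟨c, h⟩ ⟨c', h'⟩
    exact ⟨⟨_, (hf.support h h').1⟩, ⟨_, (hf.support h h').2⟩⟩
  have h₂₃ : BinLSM fun b c => if ∃ a, f a b c ≠ 0 then 1 else 0 := by
    refine binLSM_indicator ?_
    rintro a b a' b' ⟨c, h⟩ ⟨c', h'⟩
    exact ⟨⟨_, (hf.support h h').1⟩, ⟨_, (hf.support h h').2⟩⟩
  refine ⟨_, _, _, s, t, u, ⟨hp.mul h₁₂, hq.mul h₁₃, hr.mul h₂₃, hs, ht, hu⟩, ?_⟩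
  intro a b c
  by_cases h : f a b c = 0
  · rw [h]
    by_cases k₁₂ : ∃ c, f a b c ≠ 0
    · by_cases k₁₃ : ∃ b, f a b c ≠ 0
      · by_cases k₂₃ : ∃ a, f a b c ≠ 0
        · exact absurd h (hf.median k₁₂.choose_spec k₁₃.choose_spec k₂₃.choose_spec)
        · simp only [if_neg k₂₃, mul_zero, zero_mul]
      · simp only [if_neg k₁₃, mul_zero, zero_mul]
    · simp only [if_neg k₁₂, mul_zero, zero_mul]
  · rw [← regularize_eq ε1 (fun a b c a' b' c' => hε (a, b, c) (a', b', c')) h, hg]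
    simp only [if_pos (⟨c, h⟩ : ∃ c, f a b c ≠ 0), if_pos (⟨b, h⟩ : ∃ b, f a b c ≠ 0),
      if_pos (⟨a, h⟩ : ∃ a, f a b c ≠ 0), mul_one]

theorem ppsRep_of_hasGadget {F : FnOn ℝ≥0 3} (h : HasGadget fun a b c => F ![a, b, c]) :
    PpsRep ℝ≥0 (LSMk 2) F := by
  obtain ⟨p, q, r, s, t, u, ⟨hp, hq, hr, hs, ht, hu⟩, h⟩ := h
  let B : Fin 6 → Bool → Bool → ℝ≥0 := ![p, q, r, s, t, u]
  let S : Fin 6 → Fin 2 → Fin 3 ⊕ Unit :=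
    ![![.inl 0, .inl 1], ![.inl 0, .inl 2], ![.inl 1, .inl 2],
      ![.inl 0, .inr ()], ![.inl 1, .inr ()], ![.inl 2, .inr ()]]
  have hB : ∀ j, BinLSM (B j) := by
    intro j
    fin_cases j <;> assumption
  refine ppsRep_of_fintype (κ := Unit) (ι := Fin 6) (fun j => ⟨2, fun x => B j (x 0) (x 1)⟩) S
    (fun j => (hB j).mem_LSMk) fun x => ?_
  have hx : x = ![x 0, x 1, x 2] := by
    funext i
    fin_cases i <;> rfl
  rw [hx]
  refine (h _ _ _).trans ?_
  rw [← (Equiv.funUnique Unit Bool).symm.sum_comp]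
  simp only [Fin.prod_univ_six, Finset.mul_sum]
  refine Finset.sum_congr rfl fun y _ => ?_
  simp [B, S]
  ring

theorem IsLSM.ternLSM {F : FnOn ℝ≥0 3} (hF : IsLSM F) : TernLSM fun a b c => F ![a, b, c] := by
  intro a b c a' b' c'
  convert hF ![a, b, c] ![a', b', c'] using 3 <;>
  · funext i
    fin_cases i <;> rfl

/-- Lemma: `⟨LSM₃⟩ = ⟨LSM₂⟩`. -/
theorem clone_lsm3_eq_clone_lsm2 :
    Clone ℝ≥0 (LSMk 3) = Clone ℝ≥0 (LSMk 2) := by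
  refine Set.Subset.antisymm (fun F hF => hF.trans ?_) (fun F hF => hF.trans ?_)
  · rintro ⟨k, G⟩ (⟨rfl, hG⟩ | hG)
    · exact (ppsRep_of_hasGadget hG.ternLSM.hasGadget).trans fun H hH =>
        ppsRep_of_mem (Or.inl hH)
    · exact ppsRep_of_mem (Or.inr hG)
  · rintro ⟨k, G⟩ (⟨rfl, hG⟩ | hG)
    · refine ppsRep_of_fintype (κ := Empty) (ι := Unit) (fun _ => ⟨3, fun x => G ![x 0, x 1]⟩)
        (fun _ => ![.inl 0, .inl 1, .inl 1]) (fun _ => Or.inl ⟨rfl, fun x y => ?_⟩) fun x => ?_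
      · have hsup : ![(x ⊔ y) 0, (x ⊔ y) 1] = ![x 0, x 1] ⊔ ![y 0, y 1] := by
          funext i
          fin_cases i <;> rfl
        have hinf : ![(x ⊓ y) 0, (x ⊓ y) 1] = ![x 0, x 1] ⊓ ![y 0, y 1] := by
          funext i
          fin_cases i <;> rfl
        exact (hG ![x 0, x 1] ![y 0, y 1]).trans_eq (by rw [← hsup, ← hinf])
      · have hx : x = ![x 0, x 1] := by
          funext i
          fin_cases i <;> rfl
        simp [← hx]
    · exact ppsRep_of_mem (Or.inr hG)
end
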